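/- The 27-hyperplane arrangement A in ℚ(ζ)³ (union of the H₃ reflection arrangement and the orbit of (1,-ζ²,0)^⊥) is free with exponents {{1, 11, 15}} but is not inductively free. -/

import Mathlib

open Module Matrix
open scoped Classical

namespace Arrgt

variable {K : Type*} [Field K]

/-- A (central) hyperplane arrangement in `K^n`: a finite set of kernels of
nonzero linear forms. -/
structure Arrangement (K : Type*) [Field K] (n : ℕ) where
  hyperplanes : Finset (Submodule K (Fin n → K))
  isHyp : ∀ H ∈ hyperplanes, ∃ f : (Fin n → K) →ₗ[K] K, f ≠ 0 ∧ H = LinearMap.ker f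

/-- The deletion `A \ {H}`. -/
noncomputable def Arrangement.delete {n : ℕ} (A : Arrangement K n) (H : Submodule K (Fin n → K)) :
    Arrangement K n :=
  ⟨A.hyperplanes.erase H, fun H' hH' => A.isHyp H' (Finset.mem_of_mem_erase hH')⟩

/-- The empty arrangement of rank `n`. -/
def emptyArr (K : Type*) [Field K] (n : ℕ) : Arrangement K n := ⟨∅, by simp⟩

/-- The linear polynomial in `K[x_1,...,x_n]` attached to a linear form. -/
noncomputable def linPoly {n : ℕ} (f : (Fin n → K) →ₗ[K] K) : MvPolynomial (Fin n) K :=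
  ∑ i, MvPolynomial.C (f (Pi.single i 1)) * MvPolynomial.X i

/-- `Q` is a defining polynomial of the arrangement `A`: a product of linear forms
whose kernels are exactly the hyperplanes of `A`. -/
def IsDefiningPoly {n : ℕ} (A : Arrangement K n) (Q : MvPolynomial (Fin n) K) : Prop :=
  ∃ α : Submodule K (Fin n → K) → ((Fin n → K) →ₗ[K] K),
    (∀ H ∈ A.hyperplanes, α H ≠ 0 ∧ LinearMap.ker (α H) = H) ∧
    Q = ∏ H ∈ A.hyperplanes, linPoly (α H)

/-- Evaluation of a derivation at the polynomial `Q`, as a linear map. -/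
noncomputable def evalDer {n : ℕ} (Q : MvPolynomial (Fin n) K) :
    Derivation K (MvPolynomial (Fin n) K) (MvPolynomial (Fin n) K) →ₗ[MvPolynomial (Fin n) K]
      MvPolynomial (Fin n) K where
  toFun θ := θ Q
  map_add' _ _ := rfl
  map_smul' _ _ := rfl

/-- The module `D(A) = {θ : θ(Q) ∈ Q·S}` of `A`-derivations (for a chosen defining
polynomial `Q`). -/
noncomputable def DerModule {n : ℕ} (Q : MvPolynomial (Fin n) K) :
    Submodule (MvPolynomial (Fin n) K)
      (Derivation K (MvPolynomial (Fin n) K) (MvPolynomial (Fin n) K)) :=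
  Submodule.comap (evalDer Q) (Ideal.span {Q})

/-- `A` is a free arrangement: `D(A)` is a free module over `S = K[x_1,...,x_n]`. -/
def IsFree {n : ℕ} (A : Arrangement K n) : Prop :=
  ∃ Q, IsDefiningPoly A Q ∧ Module.Free (MvPolynomial (Fin n) K) (DerModule Q)

/-- A nonzero derivation is homogeneous of polynomial degree `p` if all its
coefficients are homogeneous of degree `p`. -/
def IsHomogeneousDer {n : ℕ}
    (θ : Derivation K (MvPolynomial (Fin n) K) (MvPolynomial (Fin n) K)) (p : ℕ) : Prop :=
  θ ≠ 0 ∧ ∀ i, (θ (MvPolynomial.X i)).IsHomogeneous p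

/-- `A` is free with exponents the multiset `e`: `D(A)` has a homogeneous basis whose
polynomial degrees form the multiset `e`. -/
def HasExponents {n : ℕ} (A : Arrangement K n) (e : Multiset ℕ) : Prop :=
  ∃ Q, IsDefiningPoly A Q ∧
    ∃ (l : List ℕ) (b : Basis (Fin l.length) (MvPolynomial (Fin n) K) (DerModule Q)),
      (l : Multiset ℕ) = e ∧ ∀ i : Fin l.length, IsHomogeneousDer ((b i : DerModule Q) :
        Derivation K (MvPolynomial (Fin n) K) (MvPolynomial (Fin n) K)) (l.get i)

/-- `B` is (a model, via a linear identification `H ≅ K^n`, of) the restriction `A^H`. -/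
def IsRestriction {n : ℕ} (A : Arrangement K (n + 1)) (H : Submodule K (Fin (n + 1) → K))
    (B : Arrangement K n) : Prop :=
  ∃ e : H ≃ₗ[K] (Fin n → K),
    B.hyperplanes = (A.hyperplanes.erase H).image
      (fun H' => Submodule.map (e : H →ₗ[K] (Fin n → K)) (H'.comap H.subtype))

variable (K) in
/-- The class of inductively free arrangements. -/
inductive InductivelyFree : {n : ℕ} → Arrangement K n → Prop
  | empty (n : ℕ) : InductivelyFree (emptyArr K n)
  | add {n : ℕ} (A : Arrangement K (n + 1)) (H : Submodule K (Fin (n + 1) → K))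
      (hH : H ∈ A.hyperplanes) (B : Arrangement K n) (hB : IsRestriction A H B)
      (e' e'' : Multiset ℕ)
      (h1 : InductivelyFree (A.delete H)) (h2 : InductivelyFree B)
      (h3 : HasExponents (A.delete H) e') (h4 : HasExponents B e'')
      (h5 : e'' ≤ e') : InductivelyFree A

variable (K) in
/-- The class of recursively free arrangements. -/
inductive RecursivelyFree : {n : ℕ} → Arrangement K n → Prop
  | empty (n : ℕ) : RecursivelyFree (emptyArr K n)
  | add {n : ℕ} (A : Arrangement K (n + 1)) (H : Submodule K (Fin (n + 1) → K))
      (hH : H ∈ A.hyperplanes) (B : Arrangement K n) (hB : IsRestriction A H B)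
      (e' e'' : Multiset ℕ)
      (h1 : RecursivelyFree (A.delete H)) (h2 : RecursivelyFree B)
      (h3 : HasExponents (A.delete H) e') (h4 : HasExponents B e'')
      (h5 : e'' ≤ e') : RecursivelyFree A
  | del {n : ℕ} (A : Arrangement K (n + 1)) (H : Submodule K (Fin (n + 1) → K))
      (hH : H ∈ A.hyperplanes) (B : Arrangement K n) (hB : IsRestriction A H B)
      (e e'' : Multiset ℕ)
      (h1 : RecursivelyFree A) (h2 : RecursivelyFree B)
      (h3 : HasExponents A e) (h4 : HasExponents B e'')
      (h5 : e'' ≤ e) : RecursivelyFree (A.delete H)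

/-- The intersection lattice of a set of hyperplanes: all intersections of finite
subsets (including the ambient space `⊤` as the empty intersection). -/
def setLattice {n : ℕ} (𝓐 : Set (Submodule K (Fin n → K))) : Set (Submodule K (Fin n → K)) :=
  {X | ∃ s : Finset (Submodule K (Fin n → K)), ↑s ⊆ 𝓐 ∧ X = s.inf id}

/-- The intersection lattice of an arrangement. -/
def Arrangement.lattice {n : ℕ} (A : Arrangement K n) : Set (Submodule K (Fin n → K)) :=
  setLattice (↑A.hyperplanes)

/-- The linear form `x ↦ ∑ v i * x i` attached to a normal vector `v`. -/
noncomputable def lf {n : ℕ} (v : Fin n → K) : (Fin n → K) →ₗ[K] K :=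
  ∑ i, v i • LinearMap.proj i

lemma lf_single {n : ℕ} (v : Fin n → K) (j : Fin n) : lf v (Pi.single j 1) = v j := by
  simp [lf, Pi.single_apply, mul_ite, Finset.sum_ite_eq']

lemma lf_ne_zero {n : ℕ} {v : Fin n → K} (hv : v ≠ 0) : lf v ≠ 0 := by
  intro h
  apply hv
  funext j
  have := congrArg (fun f : (Fin n → K) →ₗ[K] K => f (Pi.single j 1)) h
  simpa [lf_single] using this

/-- The hyperplane `v^⊥` with normal vector `v`. -/
noncomputable def perp {n : ℕ} (v : Fin n → K) : Submodule K (Fin n → K) :=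
  LinearMap.ker (lf v)

/-- Build an arrangement from a finite set of nonzero normal vectors. -/
noncomputable def mkArr {n : ℕ} (vs : Finset (Fin n → K)) (h : (0 : Fin n → K) ∉ vs) :
    Arrangement K n :=
  ⟨vs.image perp, by
    intro H hH
    obtain ⟨v, hv, rfl⟩ := Finset.mem_image.mp hH
    exact ⟨lf v, lf_ne_zero (fun h0 => h (h0 ▸ hv)), rfl⟩⟩

end Arrgt

namespace Arrgt

open MvPolynomial

section LinearForms

variable {K : Type*} [Field K] {n : ℕ}

lemma eval_linPoly (f : (Fin n → K) →ₗ[K] K) (x : Fin n → K) : eval x (linPoly f) = f x := by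
  have hx : x = ∑ i, x i • (Pi.single i 1 : Fin n → K) := by
    funext j
    simp [Finset.sum_apply, Pi.single_apply]
  conv_rhs => rw [hx]
  simp [linPoly, mul_comm]

lemma linPoly_smul (c : K) (f : (Fin n → K) →ₗ[K] K) : linPoly (c • f) = C c * linPoly f := by
  simp [linPoly, Finset.mul_sum, mul_assoc]

lemma exists_single_ne_zero {f : (Fin n → K) →ₗ[K] K} (hf : f ≠ 0) :
    ∃ i, f (Pi.single i 1) ≠ 0 := by
  by_contra! h
  exact hf (LinearMap.pi_ext' fun i => LinearMap.ext_ring (by simpa using h i))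

lemma linPoly_ne_zero {f : (Fin n → K) →ₗ[K] K} (hf : f ≠ 0) : linPoly f ≠ 0 := by
  obtain ⟨i, hi⟩ := exists_single_ne_zero hf
  intro h
  apply hi
  rw [← eval_linPoly, h, map_zero]

lemma isHomogeneous_linPoly (f : (Fin n → K) →ₗ[K] K) : (linPoly f).IsHomogeneous 1 :=
  IsHomogeneous.sum _ _ _ fun i _ => by
    simpa using (isHomogeneous_C (Fin n) (f (Pi.single i 1))).mul (isHomogeneous_X K i)

lemma prime_linPoly {f : (Fin n → K) →ₗ[K] K} (hf : f ≠ 0) : Prime (linPoly f) := by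
  refine Irreducible.prime (irreducible_of_totalDegree_eq_one
    ((isHomogeneous_linPoly f).totalDegree (linPoly_ne_zero hf)) fun x hx => ?_)
  obtain ⟨m, hm⟩ := ne_zero_iff.1 (linPoly_ne_zero hf)
  exact isUnit_iff_ne_zero.2 fun h => hm (by simpa [h] using hx m)

lemma eq_smul_of_ker_le {f g : (Fin n → K) →ₗ[K] K} (hf : f ≠ 0)
    (h : LinearMap.ker f ≤ LinearMap.ker g) : ∃ c : K, g = c • f := by
  obtain ⟨i, hi⟩ := exists_single_ne_zero hf
  set e : Fin n → K := Pi.single i 1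
  refine ⟨g e / f e, LinearMap.ext fun y => ?_⟩
  have hy : y - (f y / f e) • e ∈ LinearMap.ker f := by simp [hi]
  have := h hy
  simp only [LinearMap.mem_ker, map_sub, map_smul, smul_eq_mul, sub_eq_zero] at this
  rw [this, LinearMap.smul_apply, smul_eq_mul]
  ring

lemma ker_eq_of_linPoly_dvd {f g : (Fin n → K) →ₗ[K] K} (hf : f ≠ 0) (hg : g ≠ 0)
    (h : linPoly f ∣ linPoly g) : LinearMap.ker f = LinearMap.ker g := by
  obtain ⟨c, rfl⟩ := eq_smul_of_ker_le (g := g) hf fun x hx => by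
    obtain ⟨p, hp⟩ := h
    rw [LinearMap.mem_ker] at hx ⊢
    rw [← eval_linPoly, hp, map_mul, eval_linPoly, hx, zero_mul]
  refine (LinearMap.ker_smul f c ?_).symm
  rintro rfl
  simp at hg

lemma linPoly_dvd_of_ker_eq {f g : (Fin n → K) →ₗ[K] K} (hf : f ≠ 0)
    (h : LinearMap.ker f = LinearMap.ker g) : linPoly f ∣ linPoly g := by
  obtain ⟨c, rfl⟩ := eq_smul_of_ker_le hf h.le
  exact ⟨C c, by rw [linPoly_smul, mul_comm]⟩

lemma linPoly_dvd_derivation_iff {f g : (Fin n → K) →ₗ[K] K} (hf : f ≠ 0) (hg : g ≠ 0)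
    (h : LinearMap.ker f = LinearMap.ker g)
    (θ : Derivation K (MvPolynomial (Fin n) K) (MvPolynomial (Fin n) K)) :
    linPoly f ∣ θ (linPoly f) ↔ linPoly g ∣ θ (linPoly g) := by
  obtain ⟨c, rfl⟩ := eq_smul_of_ker_le hf h.le
  have hc : c ≠ 0 := by rintro rfl; simp at hg
  have hu : IsUnit (C c : MvPolynomial (Fin n) K) := (isUnit_iff_ne_zero.2 hc).map C
  rw [linPoly_smul, Derivation.leibniz, derivation_C, smul_zero, add_zero, smul_eq_mul,
    mul_comm (C c), mul_comm (C c), hu.mul_right_dvd, hu.dvd_mul_right]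

lemma derivation_linPoly (θ : Derivation K (MvPolynomial (Fin n) K) (MvPolynomial (Fin n) K))
    (f : (Fin n → K) →ₗ[K] K) : θ (linPoly f) = ∑ i, C (f (Pi.single i 1)) * θ (X i) := by
  simp [linPoly, Derivation.leibniz]

end LinearForms

section DerivationModule

variable {K : Type*} [Field K] {n : ℕ} {A : Arrangement K n} {Q : MvPolynomial (Fin n) K}

local notation "Der" => Derivation K (MvPolynomial (Fin n) K) (MvPolynomial (Fin n) K)

lemma derivation_sum_apply {ι : Type*} (s : Finset ι) (θ : ι → Der)
    (P : MvPolynomial (Fin n) K) : (∑ i ∈ s, θ i) P = ∑ i ∈ s, θ i P :=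
  map_sum (evalDer P) θ s

lemma mem_derModule {θ : Der} : θ ∈ DerModule Q ↔ Q ∣ θ Q :=
  Ideal.mem_span_singleton

lemma prod_dvd_derivation_prod {ι : Type*} (s : Finset ι) (p : ι → MvPolynomial (Fin n) K)
    (θ : Der) (h : ∀ i ∈ s, p i ∣ θ (p i)) : ∏ i ∈ s, p i ∣ θ (∏ i ∈ s, p i) := by
  induction s using Finset.induction_on with
  | empty => simp
  | insert a s ha ih =>
    rw [Finset.prod_insert ha, Derivation.leibniz, smul_eq_mul, smul_eq_mul]
    refine dvd_add (mul_dvd_mul_left _ (ih fun i hi => h i (Finset.mem_insert_of_mem hi))) ?_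
    rw [mul_comm]
    exact mul_dvd_mul_left _ (h a (Finset.mem_insert_self a s))

lemma mem_derModule_iff (hQ : IsDefiningPoly A Q) {θ : Der} :
    θ ∈ DerModule Q ↔ ∀ f : (Fin n → K) →ₗ[K] K, f ≠ 0 → LinearMap.ker f ∈ A.hyperplanes →
      linPoly f ∣ θ (linPoly f) := by
  obtain ⟨α, hα, rfl⟩ := hQ
  rw [mem_derModule]
  constructor
  · intro h f hf hfA
    obtain ⟨hα0, hαk⟩ := hα _ hfA
    rw [← linPoly_dvd_derivation_iff hα0 hf hαk]
    set H := LinearMap.ker f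
    have hp := prime_linPoly hα0
    rw [← Finset.mul_prod_erase _ _ hfA, Derivation.leibniz, smul_eq_mul, smul_eq_mul] at h
    have h' := (dvd_add_right (dvd_mul_right _ _)).1 ((dvd_mul_right _ _).trans h)
    refine (hp.dvd_or_dvd h').resolve_left fun h2 => ?_
    obtain ⟨H', hH', hd⟩ := (hp.dvd_finsetProd_iff _).1 h2
    obtain ⟨hne, hA⟩ := Finset.mem_erase.1 hH'
    obtain ⟨hβ0, hβk⟩ := hα _ hA
    exact hne (by rw [← hβk, ← hαk, ker_eq_of_linPoly_dvd hα0 hβ0 hd])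
  · intro h
    refine prod_dvd_derivation_prod _ _ θ fun H hH => h _ (hα H hH).1 ?_
    rwa [(hα H hH).2]

/-- A polynomial divisible by every linear form of the arrangement is divisible by the
defining polynomial. -/
lemma definingPoly_dvd (hQ : IsDefiningPoly A Q) {P : MvPolynomial (Fin n) K}
    (h : ∀ f : (Fin n → K) →ₗ[K] K, f ≠ 0 → LinearMap.ker f ∈ A.hyperplanes → linPoly f ∣ P) :
    Q ∣ P := by
  obtain ⟨α, hα, rfl⟩ := hQ
  refine Finset.prod_dvd_of_isRelPrime (fun H hH H' hH' hne => ?_) fun H hH =>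
    h _ (hα H hH).1 (by rwa [(hα H hH).2])
  refine (prime_linPoly (hα H hH).1).irreducible.isRelPrime_iff_not_dvd.2 fun hd => hne ?_
  rw [← (hα H hH).2, ← (hα H' hH').2, ker_eq_of_linPoly_dvd (hα H hH).1 (hα H' hH').1 hd]

lemma linPoly_dvd_definingPoly (hQ : IsDefiningPoly A Q) {f : (Fin n → K) →ₗ[K] K} (hf : f ≠ 0)
    (hfA : LinearMap.ker f ∈ A.hyperplanes) : linPoly f ∣ Q := by
  obtain ⟨α, hα, rfl⟩ := hQ
  exact (linPoly_dvd_of_ker_eq hf (hα _ hfA).2.symm).trans (Finset.dvd_prod_of_mem _ hfA)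

lemma definingPoly_ne_zero (hQ : IsDefiningPoly A Q) : Q ≠ 0 := by
  obtain ⟨α, hα, rfl⟩ := hQ
  exact Finset.prod_ne_zero_iff.2 fun H hH => linPoly_ne_zero (hα H hH).1

lemma isHomogeneous_definingPoly (hQ : IsDefiningPoly A Q) :
    Q.IsHomogeneous A.hyperplanes.card := by
  obtain ⟨α, hα, rfl⟩ := hQ
  simpa using IsHomogeneous.prod A.hyperplanes _ (fun _ => 1)
    fun H _ => isHomogeneous_linPoly (α H)

lemma exists_isDefiningPoly (A : Arrangement K n) : ∃ Q, IsDefiningPoly A Q := by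
  choose! α hα using A.isHyp
  exact ⟨_, α, fun H hH => ⟨(hα H hH).1, (hα H hH).2.symm⟩, rfl⟩

/-- The coefficient matrix of a family of derivations. -/
noncomputable def coeffMatrix (θ : Fin n → Der) :
    Matrix (Fin n) (Fin n) (MvPolynomial (Fin n) K) :=
  Matrix.of fun i j => θ i (X j)

lemma definingPoly_dvd_det (hQ : IsDefiningPoly A Q) {θ : Fin n → Der}
    (hθ : ∀ i, θ i ∈ DerModule Q) : Q ∣ (coeffMatrix θ).det := by
  refine definingPoly_dvd hQ fun f hf hfA => ?_
  obtain ⟨j, hj⟩ := exists_single_ne_zero hf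
  set a : Fin n → MvPolynomial (Fin n) K := fun i => C (f (Pi.single i 1))
  have hMa : ∀ i, linPoly f ∣ (coeffMatrix θ *ᵥ a) i := fun i => by
    have := (mem_derModule_iff hQ).1 (hθ i) f hf hfA
    rw [derivation_linPoly] at this
    simpa [Matrix.mulVec, dotProduct, coeffMatrix, a, mul_comm] using this
  have hdet : (coeffMatrix θ).det * a j = ((coeffMatrix θ).adjugate *ᵥ (coeffMatrix θ *ᵥ a)) j := by
    rw [Matrix.mulVec_mulVec, Matrix.adjugate_mul, Matrix.smul_mulVec, Matrix.one_mulVec]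
    simp
  have hu : IsUnit (a j) := (isUnit_iff_ne_zero.2 hj).map C
  rw [← hu.dvd_mul_right, hdet]
  rw [Matrix.mulVec, dotProduct]
  exact Finset.dvd_sum fun i _ => (hMa i).mul_left _

lemma isHomogeneous_det {m : ℕ} {M : Matrix (Fin m) (Fin m) (MvPolynomial (Fin n) K)}
    {d : Fin m → ℕ} (h : ∀ i j, (M i j).IsHomogeneous (d i)) :
    M.det.IsHomogeneous (∑ i, d i) := by
  rw [Matrix.det_apply]
  refine IsHomogeneous.sum _ _ _ fun σ _ => ?_
  have hp : (∏ i, M (σ i) i).IsHomogeneous (∑ i, d i) := by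
    rw [← Equiv.sum_comp σ d]
    exact IsHomogeneous.prod _ _ _ fun i _ => h _ _
  rcases Int.units_eq_one_or (Equiv.Perm.sign σ) with h1 | h1 <;> rw [h1]
  · simpa using hp
  · simpa using hp.neg

lemma linearIndependent_of_det_ne_zero {θ : Fin n → Der} (h : (coeffMatrix θ).det ≠ 0) :
    LinearIndependent (MvPolynomial (Fin n) K) θ := by
  rw [Fintype.linearIndependent_iff]
  intro c hc
  have : Matrix.vecMul c (coeffMatrix θ) = 0 := by
    funext j
    have := congrArg (fun D : Der => D (X j)) hc
    rw [Matrix.vecMul, dotProduct]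
    simpa [coeffMatrix, derivation_sum_apply] using this
  exact congrFun (Matrix.eq_zero_of_vecMul_eq_zero h this)

lemma card_le_of_linearIndependent {ι : Type*} [Fintype ι] {θ : ι → DerModule Q}
    (h : LinearIndependent (MvPolynomial (Fin n) K) θ) : Fintype.card ι ≤ n := by
  have hli : LinearIndependent (MvPolynomial (Fin n) K)
      (fun i j => (θ i : Der) (X j) : ι → Fin n → MvPolynomial (Fin n) K) := by
    rw [Fintype.linearIndependent_iff]
    intro g hg
    refine Fintype.linearIndependent_iffₛ.1 h g 0 (Subtype.ext (derivation_ext fun j => ?_))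
    simpa [derivation_sum_apply, Finset.sum_apply] using congrFun hg j
  simpa using hli.fintype_card_le_finrank

/-- Saito's criterion, in the direction producing a basis of `D(A)`. -/
lemma exists_basis_of_det_eq (hQ : IsDefiningPoly A Q) {θ : Fin n → Der}
    (hθ : ∀ i, θ i ∈ DerModule Q) {c : K} (hc : c ≠ 0)
    (hdet : (coeffMatrix θ).det = C c * Q) :
    ∃ b : Basis (Fin n) (MvPolynomial (Fin n) K) (DerModule Q), ∀ i, (b i : Der) = θ i := by
  have hQ0 := definingPoly_ne_zero hQ
  have hdet0 : (coeffMatrix θ).det ≠ 0 := by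
    rw [hdet]
    exact mul_ne_zero (C_ne_zero.2 hc) hQ0
  have hli : LinearIndependent (MvPolynomial (Fin n) K)
      (fun i => (⟨θ i, hθ i⟩ : DerModule Q)) :=
    LinearIndependent.of_comp (DerModule Q).subtype (linearIndependent_of_det_ne_zero hdet0)
  refine ⟨Basis.mk hli ?_, fun i => by rw [Basis.mk_apply]⟩
  rintro ⟨η, hη⟩ -
  have hd : ∀ i, Q ∣ (coeffMatrix θ)ᵀ.cramer (fun j => η (X j)) i := fun i => by
    have : (coeffMatrix θ)ᵀ.cramer (fun j => η (X j)) i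
        = (coeffMatrix (Function.update θ i η)).det := by
      rw [Matrix.cramer_apply, ← Matrix.det_transpose, Matrix.updateCol_transpose,
        Matrix.transpose_transpose]
      congr 1
      ext k j
      by_cases hk : k = i
      · subst hk; simp [coeffMatrix]
      · simp [coeffMatrix, hk]
    rw [this]
    refine definingPoly_dvd_det hQ fun k => ?_
    by_cases hk : k = i
    · subst hk; simpa using hη
    · simpa [hk] using hθ k
  choose d hd using hd
  have hsum : η = ∑ i, (C c⁻¹ * d i) • θ i := by
    refine derivation_ext fun j => mul_left_cancel₀ hdet0 ?_
    have := congrFun (Matrix.mulVec_cramer (coeffMatrix θ)ᵀ (fun j => η (X j))) j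
    rw [Matrix.det_transpose] at this
    simp only [Pi.smul_apply, smul_eq_mul] at this
    rw [← this, Matrix.mulVec, dotProduct, derivation_sum_apply, Finset.mul_sum]
    refine Finset.sum_congr rfl fun i _ => ?_
    have hcc : (C c * C c⁻¹ : MvPolynomial (Fin n) K) = 1 := by
      rw [← C_mul, mul_inv_cancel₀ hc, C_1]
    rw [hd, hdet, Derivation.smul_apply, smul_eq_mul]
    simp only [coeffMatrix, Matrix.transpose_apply, Matrix.of_apply]
    linear_combination (-(θ i (X j)) * Q * d i) * hcc
  have hmem : (⟨η, hη⟩ : DerModule Q) = ∑ i, (C c⁻¹ * d i) • (⟨θ i, hθ i⟩ : DerModule Q) :=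
    Subtype.ext (by simpa using hsum)
  rw [hmem]
  exact Submodule.sum_mem _ fun i _ => Submodule.smul_mem _ _ (Submodule.subset_span ⟨i, rfl⟩)

variable (K n) in
/-- The Euler derivation. -/
noncomputable def eulerDer : Der := mkDerivation K X

@[simp] lemma eulerDer_X (i : Fin n) : eulerDer K n (X i) = X i := mkDerivation_X K _ i

lemma eulerDer_mem (hQ : IsDefiningPoly A Q) : eulerDer K n ∈ DerModule Q := by
  refine (mem_derModule_iff hQ).2 fun f _ _ => ?_
  rw [derivation_linPoly]
  simp [linPoly]

/-- If `θ` preserves the deletion `A \ {ker f}`, then `f θ` preserves `A`. -/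
lemma linPoly_smul_mem {Q' : MvPolynomial (Fin n) K} {f : (Fin n → K) →ₗ[K] K}
    (hQ : IsDefiningPoly A Q) (hQ' : IsDefiningPoly (A.delete (LinearMap.ker f)) Q')
    {θ : Der} (hθ : θ ∈ DerModule Q') : linPoly f • θ ∈ DerModule Q := by
  refine (mem_derModule_iff hQ).2 fun g hg hgA => ?_
  rw [Derivation.smul_apply, smul_eq_mul]
  by_cases h : LinearMap.ker g = LinearMap.ker f
  · exact (linPoly_dvd_of_ker_eq hg h).mul_right _
  · exact ((mem_derModule_iff hQ').1 hθ g hg (Finset.mem_erase.2 ⟨h, hgA⟩)).mul_left _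

end DerivationModule

section RankTwo

variable {K : Type*} [Field K] {B : Arrangement K 2} {Q : MvPolynomial (Fin 2) K}

local notation "Der₂" => Derivation K (MvPolynomial (Fin 2) K) (MvPolynomial (Fin 2) K)

/-- The derivation `∂Q/∂x₁ ∂₀ - ∂Q/∂x₀ ∂₁`, which annihilates `Q`. -/
noncomputable def hamiltonianDer (Q : MvPolynomial (Fin 2) K) :
    Der₂ :=
  pderiv 1 Q • pderiv 0 - pderiv 0 Q • pderiv 1

lemma hamiltonianDer_mem (Q : MvPolynomial (Fin 2) K) : hamiltonianDer Q ∈ DerModule Q := by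
  rw [mem_derModule]
  simp [hamiltonianDer, mul_comm]

lemma det_euler_hamiltonian (hQ : IsDefiningPoly B Q) :
    (coeffMatrix ![eulerDer K 2, hamiltonianDer Q]).det
      = C (-(B.hyperplanes.card : K)) * Q := by
  have h := (isHomogeneous_definingPoly hQ).sum_X_mul_pderiv
  rw [Fin.sum_univ_two, nsmul_eq_mul] at h
  rw [Matrix.det_fin_two]
  simp only [coeffMatrix, hamiltonianDer, Matrix.of_apply, Matrix.cons_val_zero,
    Matrix.cons_val_one, eulerDer_X, Derivation.sub_apply, Derivation.smul_apply, pderiv_X_self,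
    smul_eq_mul, pderiv_X_of_ne (zero_ne_one : (0 : Fin 2) ≠ 1),
    pderiv_X_of_ne (one_ne_zero : (1 : Fin 2) ≠ 0), map_neg, map_natCast]
  linear_combination -h

/-- The exponents of a nonempty arrangement of rank two are two numbers whose sum is at most the
number of lines. -/
lemma exists_pair_of_hasExponents [CharZero K] {e : Multiset ℕ} (hB : B.hyperplanes.Nonempty)
    (he : HasExponents B e) : ∃ a b : ℕ, e = {a, b} ∧ a + b ≤ B.hyperplanes.card := by
  obtain ⟨Q, hQ, l, θ, rfl, hθ⟩ := he
  have hc : (-(B.hyperplanes.card : K)) ≠ 0 := by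
    simpa using hB.ne_empty
  have hmQ : C (-(B.hyperplanes.card : K)) * Q ≠ 0 :=
    mul_ne_zero (C_ne_zero.2 hc) (definingPoly_ne_zero hQ)
  have hlen : l.length = 2 := by
    apply le_antisymm
    · simpa using card_le_of_linearIndependent (Q := Q) θ.linearIndependent
    · have hli : LinearIndependent (MvPolynomial (Fin 2) K)
          (![⟨eulerDer K 2, eulerDer_mem hQ⟩, ⟨hamiltonianDer Q, hamiltonianDer_mem Q⟩] :
            Fin 2 → DerModule Q) := by
        refine LinearIndependent.of_comp (DerModule Q).subtype ?_
        convert linearIndependent_of_det_ne_zero (θ := ![eulerDer K 2, hamiltonianDer Q]) ?_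
          using 1
        · funext i; fin_cases i <;> rfl
        · rwa [det_euler_hamiltonian hQ]
      have := Module.Finite.of_basis θ
      simpa [Module.finrank_eq_card_basis θ] using hli.fintype_card_le_finrank
  obtain ⟨a, b, rfl⟩ : ∃ a b, l = [a, b] := List.length_eq_two.1 hlen
  refine ⟨a, b, rfl, ?_⟩
  let θ' : Basis (Fin 2) (MvPolynomial (Fin 2) K) (DerModule Q) := θ
  have hθ' : ∀ i, IsHomogeneousDer ((θ' i : DerModule Q) : Der₂) (![a, b] i) := fun i => by
    fin_cases i
    · exact hθ 0
    · exact hθ 1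
  set M := coeffMatrix fun i => ((θ' i : DerModule Q) : Der₂)
  have hfac : ∀ η : Fin 2 → DerModule Q,
      M.det ∣ (coeffMatrix fun i => (η i : Der₂)).det := by
    intro η
    refine ⟨(Matrix.of fun i j => θ'.repr (η i) j).det, ?_⟩
    rw [mul_comm, ← Matrix.det_mul]
    congr 1
    ext1 i j
    have h := congrArg (fun D : DerModule Q => (D : Der₂) (X j)) (θ'.sum_repr (η i))
    simp only [Fin.sum_univ_two] at h
    rw [Matrix.mul_apply, Fin.sum_univ_two]
    exact h.symm
  have hdvd : M.det ∣ C (-(B.hyperplanes.card : K)) * Q := by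
    rw [← det_euler_hamiltonian hQ]
    convert hfac ![⟨eulerDer K 2, eulerDer_mem hQ⟩, ⟨hamiltonianDer Q, hamiltonianDer_mem Q⟩]
      using 3
    funext i; fin_cases i <;> rfl
  have hhom : M.det.IsHomogeneous (∑ i, ![a, b] i) :=
    isHomogeneous_det fun i j => (hθ' i).2 j
  rw [Fin.sum_univ_two] at hhom
  obtain ⟨P, hP⟩ := hdvd
  have hM0 : M.det ≠ 0 := by rintro h; rw [h, zero_mul] at hP; exact hmQ hP
  have hP0 : P ≠ 0 := by rintro rfl; rw [mul_zero] at hP; exact hmQ hP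
  have h1 := totalDegree_mul_of_isDomain hM0 hP0
  have hQhom : (C (-(B.hyperplanes.card : K)) * Q).IsHomogeneous B.hyperplanes.card := by
    simpa using (isHomogeneous_C (Fin 2) (-(B.hyperplanes.card : K))).mul
      (isHomogeneous_definingPoly hQ)
  rw [← hP, hQhom.totalDegree hmQ, hhom.totalDegree hM0] at h1
  simp only [Matrix.cons_val_zero, Matrix.cons_val_one] at h1
  omega

end RankTwo

section RankThree

variable {K : Type*} [Field K] {n : ℕ} {A : Arrangement K 3} {Q : MvPolynomial (Fin 3) K}

local notation "Der₃" => Derivation K (MvPolynomial (Fin 3) K) (MvPolynomial (Fin 3) K)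

/-- The coefficient vector of a derivation. -/
noncomputable def coeffVec (θ : Derivation K (MvPolynomial (Fin n) K) (MvPolynomial (Fin n) K)) :
    Fin n → MvPolynomial (Fin n) K :=
  fun i => θ (X i)

lemma det_coeffMatrix_three (θ₁ θ₂ θ₃ : Der₃) :
    (coeffMatrix ![θ₁, θ₂, θ₃]).det
      = (coeffVec θ₁ ⨯₃ coeffVec θ₂) ⬝ᵥ coeffVec θ₃ := by
  rw [dotProduct_comm, triple_product_permutation, triple_product_eq_det]
  congr 1
  ext i j
  fin_cases i <;> rfl

lemma eq_zero_of_isHomogeneous_of_dvd {P R : MvPolynomial (Fin n) K} {p r : ℕ}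
    (hP : P.IsHomogeneous p) (hR : R.IsHomogeneous r) (h : P ∣ R) (hlt : r < p) : R = 0 := by
  by_contra hR0
  obtain ⟨S, rfl⟩ := h
  have hP0 : P ≠ 0 := left_ne_zero_of_mul hR0
  have h1 := totalDegree_mul_of_isDomain hP0 (right_ne_zero_of_mul hR0)
  rw [hR.totalDegree hR0, hP.totalDegree hP0] at h1
  omega

lemma isHomogeneous_cross {u v : Fin 3 → MvPolynomial (Fin n) K} {p q : ℕ}
    (hu : ∀ i, (u i).IsHomogeneous p) (hv : ∀ i, (v i).IsHomogeneous q) (i : Fin 3) :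
    ((u ⨯₃ v) i).IsHomogeneous (p + q) := by
  rw [cross_apply]
  fin_cases i <;> exact ((hu _).mul (hv _)).sub ((hu _).mul (hv _))

lemma isHomogeneous_dotProduct {u v : Fin 3 → MvPolynomial (Fin n) K} {p q : ℕ}
    (hu : ∀ i, (u i).IsHomogeneous p) (hv : ∀ i, (v i).IsHomogeneous q) :
    (u ⬝ᵥ v).IsHomogeneous (p + q) :=
  IsHomogeneous.sum _ _ _ fun i _ => (hu i).mul (hv i)

lemma isHomogeneous_eulerDer (i : Fin n) : (eulerDer K n (X i)).IsHomogeneous 1 := by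
  rw [eulerDer_X]
  exact isHomogeneous_X K i

/-- Let `φ, ψ` be elements of `D(A)` forming a basis together with the Euler derivation, such that
the cross product of the Euler derivation with `φ` vanishes on no hyperplane of `A`.  Two
homogeneous derivations of a deletion of `A` whose degrees have sum at most `deg φ` are dependent. -/
lemma cross_eq_zero_of_mem_deletion {φ ψ α β : Der₃} {c : K} {d a b : ℕ}
    {f : (Fin 3 → K) →ₗ[K] K} {Q' : MvPolynomial (Fin 3) K}
    (hQ : IsDefiningPoly A Q) (hφ : φ ∈ DerModule Q) (hφd : ∀ i, (φ (X i)).IsHomogeneous d)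
    (hd : 2 * d + 2 < A.hyperplanes.card)
    (hc : c ≠ 0)
    (hdet : (coeffMatrix ![eulerDer K 3, φ, ψ]).det = C c * Q)
    (hN : ∀ g : (Fin 3 → K) →ₗ[K] K, g ≠ 0 → LinearMap.ker g ∈ A.hyperplanes →
      ∃ i, ¬ linPoly g ∣ (coeffVec (eulerDer K 3) ⨯₃ coeffVec φ) i)
    (hf : f ≠ 0) (hQ' : IsDefiningPoly (A.delete (LinearMap.ker f)) Q')
    (hα : α ∈ DerModule Q') (hαd : ∀ i, (α (X i)).IsHomogeneous a)
    (hβ : β ∈ DerModule Q') (hβd : ∀ i, (β (X i)).IsHomogeneous b) (hab : a + b ≤ d) :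
    coeffVec α ⨯₃ coeffVec β = 0 := by
  set N := coeffVec (eulerDer K 3) ⨯₃ coeffVec φ with hNdef
  set M := coeffVec α ⨯₃ coeffVec β with hMdef
  have hNd : ∀ i, (N i).IsHomogeneous (1 + d) := isHomogeneous_cross isHomogeneous_eulerDer hφd
  have hMd : ∀ i, (M i).IsHomogeneous (a + b) := isHomogeneous_cross hαd hβd
  have hmem : ∀ {θ₁ θ₂ θ₃ : Der₃}, θ₁ ∈ DerModule Q → θ₂ ∈ DerModule Q → θ₃ ∈ DerModule Q →
      Q ∣ (coeffVec θ₁ ⨯₃ coeffVec θ₂) ⬝ᵥ coeffVec θ₃ := fun h₁ h₂ h₃ => by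
    rw [← det_coeffMatrix_three]
    refine definingPoly_dvd_det hQ fun i => ?_
    fin_cases i
    exacts [h₁, h₂, h₃]
  have horth : ∀ {γ : Der₃} {g : ℕ}, γ ∈ DerModule Q' → (∀ i, (γ (X i)).IsHomogeneous g) →
      g ≤ d → N ⬝ᵥ coeffVec γ = 0 := fun {γ g} hγ hγd hg => by
    have h := hmem (eulerDer_mem hQ) hφ (linPoly_smul_mem hQ hQ' hγ)
    have hsm : coeffVec (linPoly f • γ) = linPoly f • coeffVec γ := rfl
    rw [hsm, dotProduct_smul, smul_eq_mul] at h
    have := eq_zero_of_isHomogeneous_of_dvd (isHomogeneous_definingPoly hQ)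
      ((isHomogeneous_linPoly f).mul (isHomogeneous_dotProduct hNd hγd)) h (by omega)
    exact (mul_eq_zero.1 this).resolve_left (linPoly_ne_zero hf)
  have hNα := horth hα hαd (by omega)
  have hNβ := horth hβ hβd (by omega)
  have hQN : C c * Q = N ⬝ᵥ coeffVec ψ := by rw [← hdet, det_coeffMatrix_three]
  have hpar : ∀ i, C c * Q * M i = N i * (M ⬝ᵥ coeffVec ψ) := by
    rw [hQN]
    simp only [dotProduct, Fin.sum_univ_three] at hNα hNβ ⊢
    rw [hMdef, cross_apply]
    intro i
    fin_cases i <;>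
      simp only [Fin.zero_eta, Fin.mk_one, Fin.reduceFinMk, Matrix.cons_val]
    · linear_combination
        (coeffVec ψ 1 * coeffVec β 2 - coeffVec ψ 2 * coeffVec β 1) * hNα
          - (coeffVec ψ 1 * coeffVec α 2 - coeffVec ψ 2 * coeffVec α 1) * hNβ
    · linear_combination
        (coeffVec ψ 2 * coeffVec β 0 - coeffVec ψ 0 * coeffVec β 2) * hNα
          - (coeffVec ψ 2 * coeffVec α 0 - coeffVec ψ 0 * coeffVec α 2) * hNβ
    · linear_combination
        (coeffVec ψ 0 * coeffVec β 1 - coeffVec ψ 1 * coeffVec β 0) * hNα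
          - (coeffVec ψ 0 * coeffVec α 1 - coeffVec ψ 1 * coeffVec α 0) * hNβ
  have hdvd : Q ∣ M ⬝ᵥ coeffVec ψ := definingPoly_dvd hQ fun g hg hgA => by
    obtain ⟨i, hi⟩ := hN g hg hgA
    refine ((prime_linPoly hg).dvd_or_dvd ?_).resolve_left hi
    rw [← hpar i]
    exact ((linPoly_dvd_definingPoly hQ hg hgA).mul_left _).mul_right _
  obtain ⟨m, hm⟩ := hdvd
  have hpar' : ∀ i, C c * M i = N i * m := fun i => by
    refine mul_left_cancel₀ (definingPoly_ne_zero hQ) ?_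
    linear_combination hpar i + N i * hm
  funext i
  have hCc : (C c : MvPolynomial (Fin 3) K) ≠ 0 := C_ne_zero.2 hc
  refine (mul_eq_zero.1 ?_).resolve_left hCc
  have hCM : ∀ i, (C c * M i).IsHomogeneous (0 + (a + b)) := fun i =>
    (isHomogeneous_C (Fin 3) c).mul (hMd i)
  exact eq_zero_of_isHomogeneous_of_dvd (hNd i) (hCM i) ⟨m, hpar' i⟩ (by omega)

lemma cross_ne_zero_of_basis {ι : Type*} [Fintype ι]
    (b : Basis ι (MvPolynomial (Fin 3) K) (DerModule Q)) {i j : ι} (hij : i ≠ j) :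
    coeffVec (b i : Der₃) ⨯₃ coeffVec (b j : Der₃) ≠ 0 := by
  intro h
  have hv := fun k => congrFun h k
  simp only [cross_apply] at hv
  have h0 := hv 0
  have h1 := hv 1
  have h2 := hv 2
  simp only [Matrix.cons_val, Pi.zero_apply, coeffVec] at h0 h1 h2
  have hrel : ∀ k, (b j : Der₃) (X k) • b i = (b i : Der₃) (X k) • b j := fun k => by
    refine Subtype.ext (derivation_ext fun l => ?_)
    change (b j : Der₃) (X k) * (b i : Der₃) (X l) = (b i : Der₃) (X k) * (b j : Der₃) (X l)
    fin_cases k <;> fin_cases l <;>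
      simp only [Fin.zero_eta, Fin.mk_one, Fin.reduceFinMk] <;> first
      | ring1
      | linear_combination h0
      | linear_combination -h0
      | linear_combination h1
      | linear_combination -h1
      | linear_combination h2
      | linear_combination -h2
  refine b.ne_zero j (Subtype.ext (derivation_ext fun k => ?_))
  have := congrArg (fun η => b.repr η i) (hrel k)
  simpa [hij, Finsupp.single_apply, hij.symm] using this

/-- A pair contained in a list, as a multiset, comes from two distinct positions. -/
lemma exists_get_of_pair_le {l : List ℕ} {a b : ℕ} (h : ({a, b} : Multiset ℕ) ≤ l) :
    ∃ i j : Fin l.length, i ≠ j ∧ l.get i = a ∧ l.get j = b := by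
  have ha : a ∈ l := by simpa using Multiset.mem_of_le h (by simp : a ∈ ({a, b} : Multiset ℕ))
  obtain ⟨i, hi⟩ := List.get_of_mem ha
  by_cases hab : a = b
  · subst hab
    have h2 : 2 ≤ l.count a := by
      have := Multiset.count_le_of_le a h
      simpa using this
    obtain ⟨i, j, hij, h1, h2⟩ := List.duplicate_iff_exists_distinct_get.1
      (List.duplicate_iff_two_le_count.2 h2)
    exact ⟨i, j, hij.ne, h1.symm, h2.symm⟩
  · have hb : b ∈ l := by simpa using Multiset.mem_of_le h (by simp : b ∈ ({a, b} : Multiset ℕ))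
    obtain ⟨j, hj⟩ := List.get_of_mem hb
    exact ⟨i, j, by rintro rfl; exact hab (hi.symm.trans hj), hi, hj⟩

lemma not_inductivelyFree_of_restriction_card_le [CharZero K] {φ ψ : Der₃} {c : K} {d : ℕ}
    (hQ : IsDefiningPoly A Q) (hφ : φ ∈ DerModule Q) (hφd : ∀ i, (φ (X i)).IsHomogeneous d)
    (hd : 2 * d + 2 < A.hyperplanes.card)
    (hc : c ≠ 0)
    (hdet : (coeffMatrix ![eulerDer K 3, φ, ψ]).det = C c * Q)
    (hN : ∀ g : (Fin 3 → K) →ₗ[K] K, g ≠ 0 → LinearMap.ker g ∈ A.hyperplanes →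
      ∃ i, ¬ linPoly g ∣ (coeffVec (eulerDer K 3) ⨯₃ coeffVec φ) i)
    (hcard : ∀ H ∈ A.hyperplanes, ∀ B, IsRestriction A H B → B.hyperplanes.card ≤ d) :
    ¬ InductivelyFree K A := by
  intro h
  cases h with
  | empty => simp [emptyArr] at hd
  | add _ H hH B hB e' e'' h1 h2 h3 h4 h5 =>
    have hBne : B.hyperplanes.Nonempty := by
      obtain ⟨e, he⟩ := hB
      rw [he, Finset.image_nonempty, ← Finset.card_pos, Finset.card_erase_of_mem hH]
      omega
    obtain ⟨a, b, rfl, hab⟩ := exists_pair_of_hasExponents hBne h4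
    obtain ⟨Q', hQ', l, θ, rfl, hθ⟩ := h3
    obtain ⟨i, j, hij, rfl, rfl⟩ := exists_get_of_pair_le h5
    obtain ⟨f, hf, rfl⟩ := A.isHyp H hH
    exact cross_ne_zero_of_basis θ hij (cross_eq_zero_of_mem_deletion hQ hφ hφd hd hc hdet hN
      hf hQ' (θ i).2 (hθ i).2 (θ j).2 (hθ j).2 (hab.trans (hcard _ hH B hB)))

end RankThree

/-- The ring of integers `ℤ[ζ]` of the fifth cyclotomic field; `⟨a, b, c, d⟩` stands for
`a + b ζ + c ζ² + d ζ³`. -/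
@[ext]
structure Cyc where
  a : ℤ
  b : ℤ
  c : ℤ
  d : ℤ
deriving DecidableEq

namespace Cyc

instance : Zero Cyc := ⟨⟨0, 0, 0, 0⟩⟩
instance : One Cyc := ⟨⟨1, 0, 0, 0⟩⟩
instance : Add Cyc := ⟨fun x y => ⟨x.a + y.a, x.b + y.b, x.c + y.c, x.d + y.d⟩⟩
instance : Neg Cyc := ⟨fun x => ⟨-x.a, -x.b, -x.c, -x.d⟩⟩
instance : Sub Cyc := ⟨fun x y => ⟨x.a - y.a, x.b - y.b, x.c - y.c, x.d - y.d⟩⟩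
instance : Mul Cyc := ⟨fun x y =>
  ⟨x.a * y.a - (x.b * y.d + x.c * y.c + x.d * y.b) + (x.c * y.d + x.d * y.c),
    x.a * y.b + x.b * y.a - (x.b * y.d + x.c * y.c + x.d * y.b) + x.d * y.d,
    x.a * y.c + x.b * y.b + x.c * y.a - (x.b * y.d + x.c * y.c + x.d * y.b),
    x.a * y.d + x.b * y.c + x.c * y.b + x.d * y.a - (x.b * y.d + x.c * y.c + x.d * y.b)⟩⟩
instance : NatCast Cyc := ⟨fun n => ⟨n, 0, 0, 0⟩⟩
instance : IntCast Cyc := ⟨fun n => ⟨n, 0, 0, 0⟩⟩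

lemma zero_def : (0 : Cyc) = ⟨0, 0, 0, 0⟩ := rfl
lemma one_def : (1 : Cyc) = ⟨1, 0, 0, 0⟩ := rfl
lemma add_def (x y : Cyc) : x + y = ⟨x.a + y.a, x.b + y.b, x.c + y.c, x.d + y.d⟩ := rfl
lemma neg_def (x : Cyc) : -x = ⟨-x.a, -x.b, -x.c, -x.d⟩ := rfl
lemma sub_def (x y : Cyc) : x - y = ⟨x.a - y.a, x.b - y.b, x.c - y.c, x.d - y.d⟩ := rfl
lemma mul_def (x y : Cyc) : x * y =
    ⟨x.a * y.a - (x.b * y.d + x.c * y.c + x.d * y.b) + (x.c * y.d + x.d * y.c),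
      x.a * y.b + x.b * y.a - (x.b * y.d + x.c * y.c + x.d * y.b) + x.d * y.d,
      x.a * y.c + x.b * y.b + x.c * y.a - (x.b * y.d + x.c * y.c + x.d * y.b),
      x.a * y.d + x.b * y.c + x.c * y.b + x.d * y.a - (x.b * y.d + x.c * y.c + x.d * y.b)⟩ := rfl
lemma natCast_def (n : ℕ) : (n : Cyc) = ⟨n, 0, 0, 0⟩ := rfl
lemma intCast_def (n : ℤ) : (n : Cyc) = ⟨n, 0, 0, 0⟩ := rfl

instance : CommRing Cyc where
  add_assoc x y z := by simp only [add_def, add_assoc]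
  zero_add x := by simp only [add_def, zero_def, zero_add]
  add_zero x := by simp only [add_def, zero_def, add_zero]
  add_comm x y := by simp only [add_def, add_comm]
  neg_add_cancel x := by simp only [add_def, neg_def, zero_def, neg_add_cancel]
  sub_eq_add_neg x y := by simp only [add_def, neg_def, sub_def, sub_eq_add_neg]
  nsmul := nsmulRec
  zsmul := zsmulRec
  mul_assoc x y z := by simp only [mul_def, mk.injEq]; refine ⟨?_, ?_, ?_, ?_⟩ <;> ring
  one_mul x := by simp only [mul_def, one_def]; ext <;> ring
  mul_one x := by simp only [mul_def, one_def]; ext <;> ring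
  mul_comm x y := by simp only [mul_def, mk.injEq]; refine ⟨?_, ?_, ?_, ?_⟩ <;> ring
  zero_mul x := by simp only [mul_def, zero_def]; ext <;> ring
  mul_zero x := by simp only [mul_def, zero_def]; ext <;> ring
  left_distrib x y z := by
    simp only [mul_def, add_def, mk.injEq]; refine ⟨?_, ?_, ?_, ?_⟩ <;> ring
  right_distrib x y z := by
    simp only [mul_def, add_def, mk.injEq]; refine ⟨?_, ?_, ?_, ?_⟩ <;> ring
  natCast_zero := rfl
  natCast_succ n := by simp [natCast_def, one_def, add_def]
  intCast_ofNat n := by simp [natCast_def, intCast_def]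
  intCast_negSucc n := by ext <;> simp [natCast_def, intCast_def, neg_def, Int.negSucc_eq]

/-- The generator of `ℤ[ζ]`. -/
def zeta : Cyc := ⟨0, 1, 0, 0⟩

variable {ζ : ℂ}

lemma sum_pow_eq_zero (hζ : IsPrimitiveRoot ζ 5) : 1 + ζ + ζ ^ 2 + ζ ^ 3 + ζ ^ 4 = 0 := by
  simpa [Finset.sum_range_succ] using hζ.geom_sum_eq_zero (by norm_num)

/-- The embedding of `ℤ[ζ]` in `ℂ` given by a primitive fifth root of unity. -/
noncomputable def toComplex (hζ : IsPrimitiveRoot ζ 5) : Cyc →+* ℂ where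
  toFun x := x.a + x.b * ζ + x.c * ζ ^ 2 + x.d * ζ ^ 3
  map_zero' := by simp [zero_def]
  map_one' := by simp [one_def]
  map_add' x y := by simp only [add_def]; push_cast; ring
  map_mul' x y := by
    simp only [mul_def]
    push_cast
    linear_combination (-(x.b * y.d + x.c * y.c + x.d * y.b) + (1 - ζ) * (x.c * y.d + x.d * y.c)
      + (ζ - ζ ^ 2) * x.d * y.d : ℂ) * sum_pow_eq_zero hζ

lemma toComplex_apply (hζ : IsPrimitiveRoot ζ 5) (x : Cyc) :
    toComplex hζ x = x.a + x.b * ζ + x.c * ζ ^ 2 + x.d * ζ ^ 3 := rfl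

lemma toComplex_zeta (hζ : IsPrimitiveRoot ζ 5) : toComplex hζ zeta = ζ := by
  simp [toComplex_apply, zeta]

lemma toComplex_injective (hζ : IsPrimitiveRoot ζ 5) : Function.Injective (toComplex hζ) := by
  rw [injective_iff_map_eq_zero]
  intro x hx
  let P : Polynomial ℤ := .C x.a + .C x.b * .X + .C x.c * .X ^ 2 + .C x.d * .X ^ 3
  have hP : Polynomial.aeval ζ P = 0 := by
    rw [← hx, toComplex_apply]
    simp [P]
  have hdvd := minpoly.isIntegrallyClosed_dvd (hζ.isIntegral (by norm_num)) hP
  rw [← Polynomial.cyclotomic_eq_minpoly hζ (by norm_num)] at hdvd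
  have h0 : P = 0 := by
    refine Polynomial.eq_zero_of_dvd_of_natDegree_lt hdvd ?_
    rw [Polynomial.natDegree_cyclotomic, Nat.totient_prime (by norm_num)]
    refine lt_of_le_of_lt (b := 3) ?_ (by norm_num)
    simp only [P]
    compute_degree
  have hco := fun k => congrArg (fun R : Polynomial ℤ => R.coeff k) h0
  have h₀ := hco 0
  have h₁ := hco 1
  have h₂ := hco 2
  have h₃ := hco 3
  simp [P, Polynomial.coeff_X, Polynomial.coeff_C, -eq_intCast] at h₀ h₁ h₂ h₃
  ext
  exacts [h₀, h₁, h₂, h₃]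

end Cyc

section Pencil

variable {R : Type*} [CommRing R]

/-- The `k`-th power sum of `a`. -/
def powSum {m : ℕ} (a : Fin m → R) (k : ℕ) : R := ∑ i, a i ^ k

/-- The `k`-th power sum of `a` with weights `b`. -/
def wPowSum {m : ℕ} (b a : Fin m → R) (k : ℕ) : R := ∑ i, b i * a i ^ k

/-- The coefficient, in the direction with pairings `b` against the axes of an icosahedron, of an
invariant derivation of degree 11 at a point with coordinates `a` along these axes. -/
def psi₁₁ (b a : Fin 6 → R) : R :=
  300 * powSum a 2 * wPowSum b a 9 - (20 * powSum a 6 + 73 * powSum a 2 ^ 3) * wPowSum b a 5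

/-- The analogue of `psi₁₁` for an invariant derivation of degree 15. -/
def psi₁₅ (b a : Fin 6 → R) : R :=
  (240 * powSum a 10 + 183 * powSum a 2 ^ 5) * wPowSum b a 5
    - (200 * powSum a 6 + 730 * powSum a 2 ^ 3) * wPowSum b a 9

end Pencil

namespace Cyc

/-- The element `-ζ² - ζ³` of `ℤ[ζ]`. -/
def omega : Cyc := ⟨0, 0, -1, -1⟩

/-- The generators of the reflection group of type `H₃`. -/
def gen : Fin 3 → Matrix (Fin 3) (Fin 3) Cyc :=
  ![!![1, 0, 0; 0, 1, 1; 0, 0, -1], !![-1, 0, 0; omega, 1, 0; 0, 0, 1],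
    !![1, omega, 0; 0, -1, 0; 0, 1, 1]]

/-- The six axes of an icosahedron. -/
def axis : Fin 6 → Fin 3 → Cyc :=
  ![![omega, 2, 3 - omega], ![omega, 2, omega - 1], ![omega, 2 * omega - 2, omega - 1],
    ![2 - omega, 0, omega - 1], ![omega - 2, 0, omega - 1], ![2 - omega, 2 * omega - 2, omega - 1]]

/-- The linear forms dual to the axes for the invariant bilinear form. -/
def coaxis (i : Fin 6) : Fin 3 → Cyc :=
  axis i ᵥ* !![2, -omega, 0; -omega, 2, -1; 0, -1, 2]

/-- The normal vectors of the hyperplanes: the fifteen positive roots, up to scalars, followed by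
the orbit of an isotropic vector. -/
def normal : Fin 27 → Fin 3 → Cyc :=
  ![![1, 0, 0],
    ![1, ⟨0, 0, -1, -1⟩, 0],
    ![1, ⟨0, 0, -1, -1⟩, ⟨0, 0, -1, -1⟩],
    ![⟨0, 0, -1, -1⟩, ⟨0, 0, -1, -1⟩, 0],
    ![⟨0, 0, -1, -1⟩, ⟨0, 0, -1, -1⟩, ⟨0, 0, -1, -1⟩],
    ![⟨0, 0, -1, -1⟩, 1, 0],
    ![⟨0, 0, -1, -1⟩, ⟨1, 0, -1, -1⟩, ⟨0, 0, -1, -1⟩],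
    ![⟨0, 0, -1, -1⟩, 1, 1],
    ![0, 1, 0],
    ![⟨0, 0, -1, -1⟩, ⟨1, 0, -1, -1⟩, 1],
    ![⟨1, 0, -1, -1⟩, ⟨1, 0, -1, -1⟩, ⟨0, 0, -1, -1⟩],
    ![0, 1, 1],
    ![⟨1, 0, -1, -1⟩, ⟨1, 0, -1, -1⟩, 1],
    ![⟨1, 0, -1, -1⟩, ⟨0, 0, -2, -2⟩, ⟨0, 0, -1, -1⟩],
    ![0, 0, 1],
    ![1, ⟨0, 0, -1, 0⟩, 0],
    ![1, ⟨0, 0, -1, 0⟩, ⟨0, 0, -1, 0⟩],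
    ![⟨-1, -1, -1, -1⟩, ⟨0, 0, -1, 0⟩, 0],
    ![⟨-1, -1, -1, -1⟩, ⟨0, 0, -1, 0⟩, ⟨0, 0, -1, 0⟩],
    ![1, ⟨0, 0, -1, -1⟩, ⟨0, 0, -1, 0⟩],
    ![⟨-1, -1, -1, -1⟩, ⟨0, -1, -1, 0⟩, ⟨0, 0, -1, 0⟩],
    ![⟨0, 0, -1, -1⟩, ⟨0, 0, -1, -1⟩, ⟨0, 0, -1, 0⟩],
    ![⟨0, -1, -1, 0⟩, ⟨0, -1, -1, 0⟩, ⟨0, 0, -1, 0⟩],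
    ![⟨0, 0, -1, -1⟩, ⟨1, 0, -1, 0⟩, ⟨0, 0, -1, 0⟩],
    ![⟨0, -1, -1, 0⟩, ⟨-1, -1, -2, -1⟩, ⟨0, 0, -1, 0⟩],
    ![⟨0, 0, -1, -1⟩, ⟨1, 0, -1, 0⟩, 1],
    ![⟨0, -1, -1, -1⟩, ⟨1, 0, -1, 0⟩, ⟨0, 0, -1, 0⟩]]

/-- The permutation of the axes, up to signs, by a generator. -/
def axisPerm : Fin 3 → Fin 6 → Fin 6 :=
  ![![1, 0, 2, 4, 3, 5], ![0, 1, 5, 4, 3, 2], ![0, 2, 1, 5, 4, 3]]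

/-- The signs accompanying `axisPerm`. -/
def axisSign : Fin 3 → Fin 6 → Cyc :=
  ![![1, 1, 1, -1, -1, 1], ![1, 1, 1, 1, 1, 1], ![1, 1, 1, 1, 1, 1]]

lemma axisPerm_involutive (k : Fin 3) : Function.Involutive (axisPerm k) := by
  revert k; unfold Function.Involutive; decide +kernel

lemma axisSign_sq (k : Fin 3) (j : Fin 6) : axisSign k j ^ 2 = 1 := by
  revert k j; decide +kernel

lemma axis_vecMul_gen (k : Fin 3) (j : Fin 6) :
    axis j ᵥ* gen k = axisSign k j • axis (axisPerm k j) := by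
  revert k j; decide +kernel

lemma gen_mulVec_coaxis (k : Fin 3) (j : Fin 6) :
    axisSign k j • (gen k *ᵥ coaxis (axisPerm k j)) = coaxis j := by
  revert k j; decide +kernel

lemma gen_mul_self (k : Fin 3) : gen k * gen k = 1 := by
  revert k; decide +kernel

lemma exists_normal_eq_vecMul (i : Fin 27) (h₀ : i ≠ 0) (h₁₅ : i ≠ 15) :
    ∃ j < i, ∃ k, normal i = normal j ᵥ* gen k := by
  revert i; decide +kernel

lemma exists_normal_cross_vecMul (i : Fin 27) (k : Fin 3) :
    ∃ j, (normal i ᵥ* gen k) ⨯₃ normal j = 0 := by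
  revert i k; decide +kernel

lemma normal_cross_ne_zero (i j : Fin 27) (h : i ≠ j) : normal i ⨯₃ normal j ≠ 0 := by
  revert i j; decide +kernel

/-- The intersections of two hyperplanes, each given by the indices of the hyperplanes that
contain it. -/
def flats : List (List (Fin 27)) :=
  [[0, 1, 3, 5, 8, 15, 17], [0, 2, 4, 7, 11, 16, 18], [0, 6, 10], [0, 9, 12], [0, 13], [0, 14],
    [0, 19, 21], [0, 20, 22], [0, 23, 26], [0, 24, 25], [1, 2, 6, 9, 14, 19, 20], [1, 4, 13],
    [1, 7, 12], [1, 10], [1, 11], [1, 16, 23], [1, 18, 24], [1, 21, 25], [1, 22, 26], [2, 3, 13],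
    [2, 5, 10], [2, 8], [2, 12], [2, 15, 25], [2, 17, 26], [2, 21, 24], [2, 22, 23],
    [3, 4, 10, 12, 14, 21, 22], [3, 6], [3, 7], [3, 9, 11], [3, 16, 25], [3, 18, 26], [3, 19, 24],
    [3, 20, 23], [4, 5], [4, 6, 8], [4, 9], [4, 15, 23], [4, 17, 24], [4, 19, 25], [4, 20, 26],
    [5, 6, 11, 12, 13, 23, 24], [5, 7, 14], [5, 9], [5, 16, 22], [5, 18, 21], [5, 19, 26],
    [5, 20, 25], [6, 7], [6, 15, 22], [6, 16, 26], [6, 17, 21], [6, 18, 25],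
    [7, 8, 9, 10, 13, 25, 26], [7, 15, 21], [7, 17, 22], [7, 19, 23], [7, 20, 24], [8, 11, 14],
    [8, 12], [8, 16, 19], [8, 18, 20], [8, 21, 23], [8, 22, 24], [9, 15, 24], [9, 16, 21],
    [9, 17, 23], [9, 18, 22], [10, 11], [10, 15, 19], [10, 16, 24], [10, 17, 20], [10, 18, 23],
    [11, 15, 20], [11, 17, 19], [11, 21, 26], [11, 22, 25], [12, 15, 26], [12, 16, 20],
    [12, 17, 25], [12, 18, 19], [13, 14], [13, 15, 18], [13, 16, 17], [13, 19, 22], [13, 20, 21],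
    [14, 15, 16], [14, 17, 18], [14, 23, 25], [14, 24, 26]]

/-- A point spanning the intersection of two hyperplanes. -/
def flatPoint : List (Fin 27) → Fin 3 → Cyc
  | i :: j :: _ => normal i ⨯₃ normal j
  | _ => 0

lemma flatPoint_ne_zero : ∀ L ∈ flats, flatPoint L ≠ 0 := by
  decide +kernel

lemma normal_dotProduct_flatPoint : ∀ L ∈ flats, ∀ i ∈ L, normal i ⬝ᵥ flatPoint L = 0 := by
  decide +kernel

lemma length_filter_flats_le (i : Fin 27) : (flats.filter (i ∈ ·)).length ≤ 11 := by
  revert i; decide +kernel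

lemma exists_mem_flats (i j : Fin 27) (h : i ≠ j) : ∃ L ∈ flats, i ∈ L ∧ j ∈ L := by
  revert i j; decide +kernel

/-- The coefficients of the derivation of degree 11 at a point. -/
def field₁₁ (x : Fin 3 → Cyc) (j : Fin 3) : Cyc :=
  psi₁₁ (fun i => coaxis i j) (fun i => axis i ⬝ᵥ x)

/-- The coefficients of the derivation of degree 15 at a point. -/
def field₁₅ (x : Fin 3 → Cyc) (j : Fin 3) : Cyc :=
  psi₁₅ (fun i => coaxis i j) (fun i => axis i ⬝ᵥ x)

lemma det_fields_ne_zero :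
    (![1, 2, 5] ⨯₃ field₁₁ ![1, 2, 5]) ⬝ᵥ field₁₅ ![1, 2, 5] ≠ 0 := by
  decide +kernel

lemma cross_field_ne_zero (i : Fin 27) :
    (normal i ⨯₃ ![1, 2, 5]) ⨯₃ field₁₁ (normal i ⨯₃ ![1, 2, 5]) ≠ 0 := by
  revert i; decide +kernel

end Cyc

section Pencil

variable {R S : Type*} [CommRing R] [CommRing S]

lemma map_powSum {m : ℕ} (f : R →+* S) (a : Fin m → R) (k : ℕ) :
    f (powSum a k) = powSum (fun i => f (a i)) k := by
  simp [powSum]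

lemma map_wPowSum {m : ℕ} (f : R →+* S) (b a : Fin m → R) (k : ℕ) :
    f (wPowSum b a k) = wPowSum (fun i => f (b i)) (fun i => f (a i)) k := by
  simp [wPowSum]

lemma map_psi₁₁ (f : R →+* S) (b a : Fin 6 → R) :
    f (psi₁₁ b a) = psi₁₁ (fun i => f (b i)) (fun i => f (a i)) := by
  simp [psi₁₁, map_powSum, map_wPowSum, map_ofNat]

lemma map_psi₁₅ (f : R →+* S) (b a : Fin 6 → R) :
    f (psi₁₅ b a) = psi₁₅ (fun i => f (b i)) (fun i => f (a i)) := by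
  simp [psi₁₅, map_powSum, map_wPowSum, map_ofNat]

lemma sum_mul_wPowSum {m n : ℕ} (c : Fin n → R) (b : Fin n → Fin m → R) (a : Fin m → R) (k : ℕ) :
    ∑ j, c j * wPowSum (b j) a k = wPowSum (fun i => ∑ j, c j * b j i) a k := by
  simp only [wPowSum, Finset.mul_sum, Finset.sum_mul]
  rw [Finset.sum_comm]
  simp only [mul_assoc]

lemma sum_mul_psi₁₁ {n : ℕ} (c : Fin n → R) (b : Fin n → Fin 6 → R) (a : Fin 6 → R) :
    ∑ j, c j * psi₁₁ (b j) a = psi₁₁ (fun i => ∑ j, c j * b j i) a := by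
  simp only [psi₁₁, ← sum_mul_wPowSum, mul_sub, Finset.sum_sub_distrib, Finset.mul_sum,
    mul_left_comm (c _)]

lemma sum_mul_psi₁₅ {n : ℕ} (c : Fin n → R) (b : Fin n → Fin 6 → R) (a : Fin 6 → R) :
    ∑ j, c j * psi₁₅ (b j) a = psi₁₅ (fun i => ∑ j, c j * b j i) a := by
  simp only [psi₁₅, ← sum_mul_wPowSum, mul_sub, Finset.sum_sub_distrib, Finset.mul_sum,
    mul_left_comm (c _)]

lemma wPowSum_neg {m : ℕ} (b a : Fin m → R) (k : ℕ) :
    wPowSum (fun i => -b i) a k = -wPowSum b a k := by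
  simp [wPowSum]

lemma powSum_mul {m : ℕ} (c : R) (a : Fin m → R) (k : ℕ) :
    powSum (fun i => c * a i) k = c ^ k * powSum a k := by
  simp [powSum, mul_pow, Finset.mul_sum]

lemma wPowSum_mul {m : ℕ} (c : R) (b a : Fin m → R) (k : ℕ) :
    wPowSum b (fun i => c * a i) k = c ^ k * wPowSum b a k := by
  simp [wPowSum, mul_pow, Finset.mul_sum, mul_left_comm]

lemma powSum_signed_comp {m : ℕ} {σ : Fin m → Fin m} (hσ : σ.Bijective) {s : Fin m → R}
    (hs : ∀ i, s i ^ 2 = 1) (a : Fin m → R) (k : ℕ) :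
    powSum (fun i => s i * a (σ i)) (2 * k) = powSum a (2 * k) := by
  simp only [powSum, mul_pow, pow_mul, hs, one_mul]
  exact hσ.sum_comp fun i => (a i ^ 2) ^ k

lemma wPowSum_signed_comp {m : ℕ} {σ : Fin m → Fin m} (hσ : σ.Bijective) {s : Fin m → R}
    (hs : ∀ i, s i ^ 2 = 1) (b a : Fin m → R) (k : ℕ) :
    wPowSum (fun i => s i * b (σ i)) (fun i => s i * a (σ i)) (2 * k + 1)
      = wPowSum b a (2 * k + 1) := by
  rw [wPowSum, wPowSum, ← hσ.sum_comp fun i => b i * a i ^ (2 * k + 1)]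
  refine Finset.sum_congr rfl fun i _ => ?_
  have h : (s i ^ 2) ^ k = 1 := by rw [hs, one_pow]
  linear_combination b (σ i) * a (σ i) ^ (2 * k + 1) * (s i ^ 2 * h + hs i)

lemma psi₁₁_signed_comp {σ : Fin 6 → Fin 6} (hσ : σ.Bijective) {s : Fin 6 → R}
    (hs : ∀ i, s i ^ 2 = 1) (b a : Fin 6 → R) :
    psi₁₁ (fun i => s i * b (σ i)) (fun i => s i * a (σ i)) = psi₁₁ b a := by
  simp only [psi₁₁, powSum_signed_comp hσ hs a 1, powSum_signed_comp hσ hs a 3,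
    wPowSum_signed_comp hσ hs b a 2, wPowSum_signed_comp hσ hs b a 4]

lemma psi₁₅_signed_comp {σ : Fin 6 → Fin 6} (hσ : σ.Bijective) {s : Fin 6 → R}
    (hs : ∀ i, s i ^ 2 = 1) (b a : Fin 6 → R) :
    psi₁₅ (fun i => s i * b (σ i)) (fun i => s i * a (σ i)) = psi₁₅ b a := by
  simp only [psi₁₅, powSum_signed_comp hσ hs a 1, powSum_signed_comp hσ hs a 3,
    powSum_signed_comp hσ hs a 5, wPowSum_signed_comp hσ hs b a 2, wPowSum_signed_comp hσ hs b a 4]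

lemma psi₁₁_neg (b a : Fin 6 → R) : psi₁₁ (fun i => -b i) a = -psi₁₁ b a := by
  simp only [psi₁₁, wPowSum_neg]
  ring

lemma psi₁₅_neg (b a : Fin 6 → R) : psi₁₅ (fun i => -b i) a = -psi₁₅ b a := by
  simp only [psi₁₅, wPowSum_neg]
  ring

lemma psi₁₁_mul (c : R) (b a : Fin 6 → R) :
    psi₁₁ b (fun i => c * a i) = c ^ 11 * psi₁₁ b a := by
  simp only [psi₁₁, wPowSum_mul, powSum_mul]
  ring

lemma psi₁₅_mul (c : R) (b a : Fin 6 → R) :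
    psi₁₅ b (fun i => c * a i) = c ^ 15 * psi₁₅ b a := by
  simp only [psi₁₅, wPowSum_mul, powSum_mul]
  ring

/-- The power sums of the fifth roots of unity. -/
lemma sum_pow_roots {ζ : R} (hζ : 1 + ζ + ζ ^ 2 + ζ ^ 3 + ζ ^ 4 = 0) (k : ℕ) :
    ∑ j : Fin 5, (ζ ^ (j : ℕ)) ^ k = if 5 ∣ k then 5 else 0 := by
  have h5 : ζ ^ 5 = 1 := by linear_combination (ζ - 1) * hζ
  have hj : ∀ j : ℕ, (ζ ^ j) ^ 5 = 1 := fun j => by rw [pow_right_comm, h5, one_pow]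
  have h1 : ∑ j : Fin 5, (ζ ^ (j : ℕ)) ^ k = ∑ j : Fin 5, (ζ ^ (j : ℕ)) ^ (k % 5) := by
    refine Finset.sum_congr rfl fun j _ => ?_
    conv_lhs => rw [← Nat.div_add_mod k 5]
    rw [pow_add, pow_mul, hj, one_pow, one_mul]
  simp only [h1, Nat.dvd_iff_mod_eq_zero]
  have hk := Nat.mod_lt k (by norm_num : 5 > 0)
  interval_cases k % 5
  · simp
  · simp [Fin.sum_univ_five, hζ]
  all_goals
    simp only [Fin.sum_univ_five, Fin.coe_ofNat_eq_mod]
    norm_num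
    grind

lemma sum_pow_mul_binomial {ζ : R} (hζ : 1 + ζ + ζ ^ 2 + ζ ^ 3 + ζ ^ 4 = 0) (m y : R) (i n : ℕ) :
    ∑ j : Fin 5, (ζ ^ (j : ℕ)) ^ i * (m + ζ ^ (j : ℕ) * y) ^ n
      = ∑ k ∈ Finset.range (n + 1),
          if 5 ∣ i + k then 5 * (n.choose k : R) * y ^ k * m ^ (n - k) else 0 := by
  have h : ∀ j : Fin 5, (ζ ^ (j : ℕ)) ^ i * (m + ζ ^ (j : ℕ) * y) ^ n
      = ∑ k ∈ Finset.range (n + 1),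
          (n.choose k : R) * y ^ k * m ^ (n - k) * (ζ ^ (j : ℕ)) ^ (i + k) := fun j => by
    rw [add_comm m, add_pow, Finset.mul_sum]
    exact Finset.sum_congr rfl fun k _ => by ring
  simp only [h]
  rw [Finset.sum_comm]
  refine Finset.sum_congr rfl fun k _ => ?_
  rw [← Finset.mul_sum, sum_pow_roots hζ]
  split_ifs <;> ring

lemma powSum_isotropic {ζ : R} (hζ : 1 + ζ + ζ ^ 2 + ζ ^ 3 + ζ ^ 4 = 0) (m y s : R) (n : ℕ) :
    powSum (Fin.cons (s * m) fun j : Fin 5 => m + ζ ^ (j : ℕ) * y : Fin 6 → R) n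
      = (s * m) ^ n + ∑ k ∈ Finset.range (n + 1),
          if 5 ∣ k then 5 * (n.choose k : R) * y ^ k * m ^ (n - k) else 0 := by
  have := sum_pow_mul_binomial hζ m y 0 n
  simp only [pow_zero, one_mul, zero_add] at this
  rw [powSum, Fin.sum_univ_succ, ← this]
  simp

lemma wPowSum_isotropic {ζ : R} (hζ : 1 + ζ + ζ ^ 2 + ζ ^ 3 + ζ ^ 4 = 0) (m y s κ : R) (n : ℕ) :
    wPowSum (Fin.cons 0 fun j : Fin 5 => κ * ζ ^ (j : ℕ) : Fin 6 → R)
        (Fin.cons (s * m) fun j : Fin 5 => m + ζ ^ (j : ℕ) * y) n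
      = κ * ∑ k ∈ Finset.range (n + 1),
          if 5 ∣ 1 + k then 5 * (n.choose k : R) * y ^ k * m ^ (n - k) else 0 := by
  have := sum_pow_mul_binomial hζ m y 1 n
  simp only [pow_one] at this
  rw [wPowSum, Fin.sum_univ_succ, ← this]
  simp [Finset.mul_sum, mul_assoc]

lemma psi₁₁_isotropic {ζ s : R} (hζ : 1 + ζ + ζ ^ 2 + ζ ^ 3 + ζ ^ 4 = 0) (hs : s ^ 2 = 5)
    (m y κ : R) :
    psi₁₁ (Fin.cons 0 fun j : Fin 5 => κ * ζ ^ (j : ℕ))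
      (Fin.cons (s * m) fun j : Fin 5 => m + ζ ^ (j : ℕ) * y) = 0 := by
  have h6 : s ^ 6 = 125 := by linear_combination (s ^ 4 + 5 * s ^ 2 + 25) * hs
  simp only [psi₁₁, powSum_isotropic hζ, wPowSum_isotropic hζ, Finset.sum_range_succ,
    Finset.sum_range_zero, mul_pow, hs, h6]
  norm_num [Nat.choose]
  ring

lemma psi₁₅_isotropic {ζ s : R} (hζ : 1 + ζ + ζ ^ 2 + ζ ^ 3 + ζ ^ 4 = 0) (hs : s ^ 2 = 5)
    (m y κ : R) :
    psi₁₅ (Fin.cons 0 fun j : Fin 5 => κ * ζ ^ (j : ℕ))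
      (Fin.cons (s * m) fun j : Fin 5 => m + ζ ^ (j : ℕ) * y) = 0 := by
  have h6 : s ^ 6 = 125 := by linear_combination (s ^ 4 + 5 * s ^ 2 + 25) * hs
  have h10 : s ^ 10 = 3125 := by linear_combination s ^ 4 * h6 + (125 * s ^ 2 + 625) * hs
  simp only [psi₁₅, powSum_isotropic hζ, wPowSum_isotropic hζ, Finset.sum_range_succ,
    Finset.sum_range_zero, mul_pow, hs, h6, h10]
  norm_num [Nat.choose]
  ring

end Pencil

section Perp

variable {K : Type*} [Field K] {n : ℕ}

lemma lf_apply (v x : Fin n → K) : lf v x = v ⬝ᵥ x := by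
  simp [lf, dotProduct]

lemma mem_perp {v x : Fin n → K} : x ∈ perp v ↔ v ⬝ᵥ x = 0 := by
  rw [perp, LinearMap.mem_ker, lf_apply]

lemma perp_smul {c : K} (hc : c ≠ 0) (v : Fin n → K) : perp (c • v) = perp v := by
  ext x
  simp [mem_perp, hc]

lemma exists_smul_of_cross_eq_zero {v w : Fin 3 → K} (hv : v ≠ 0) (h : v ⨯₃ w = 0) :
    ∃ c : K, c • v = w := by
  by_contra! hc
  exact crossProduct_ne_zero_iff_linearIndependent.2
    ((LinearIndependent.pair_iff' hv).2 hc) h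

lemma perp_eq_iff {v w : Fin 3 → K} (hv : v ≠ 0) (hw : w ≠ 0) :
    perp v = perp w ↔ v ⨯₃ w = 0 := by
  constructor
  · intro h
    obtain ⟨c, hc⟩ := eq_smul_of_ker_le (lf_ne_zero hv) h.le
    have : w = c • v := by
      funext j
      rw [← lf_single w, hc]
      simp [lf_single]
    rw [this, map_smul, cross_self, smul_zero]
  · intro h
    obtain ⟨c, rfl⟩ := exists_smul_of_cross_eq_zero hv h
    exact (perp_smul (left_ne_zero_of_smul hw) v).symm

/-- The intersection of two distinct planes through a nonzero point is spanned by that point. -/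
lemma perp_inf_perp {v w p : Fin 3 → K} (hvw : v ⨯₃ w ≠ 0) (hp : p ≠ 0) (hv : v ⬝ᵥ p = 0)
    (hw : w ⬝ᵥ p = 0) : perp v ⊓ perp w = Submodule.span K {p} := by
  have key : ∀ x, v ⬝ᵥ x = 0 → w ⬝ᵥ x = 0 → (v ⨯₃ w) ⨯₃ x = 0 := fun x h₁ h₂ => by
    rw [cross_cross_eq_smul_sub_smul, h₁, h₂, zero_smul, zero_smul, sub_zero]
  ext x
  rw [Submodule.mem_inf, mem_perp, mem_perp, Submodule.mem_span_singleton]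
  constructor
  · rintro ⟨h₁, h₂⟩
    obtain ⟨c, rfl⟩ := exists_smul_of_cross_eq_zero hvw (key x h₁ h₂)
    obtain ⟨d, rfl⟩ := exists_smul_of_cross_eq_zero hvw (key p hv hw)
    have hd : d ≠ 0 := left_ne_zero_of_smul hp
    exact ⟨c / d, by rw [smul_smul, div_mul_cancel₀ _ hd]⟩
  · rintro ⟨c, rfl⟩
    simp [hv, hw]

/-- A polynomial vanishing on a hyperplane is divisible by its equation. -/
lemma linPoly_dvd_of_eval_eq_zero [Infinite K] {f : (Fin n → K) →ₗ[K] K} (hf : f ≠ 0)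
    {P : MvPolynomial (Fin n) K} (h : ∀ x, f x = 0 → eval x P = 0) : linPoly f ∣ P := by
  obtain ⟨i, hi⟩ := exists_single_ne_zero hf
  set e : Fin n → K := Pi.single i 1
  set s : Fin n → MvPolynomial (Fin n) K := fun j => X j - C (e j / f e) * linPoly f
  have hs : aeval s P = 0 := by
    refine MvPolynomial.funext fun x => ?_
    have hx : (fun j => eval x (s j)) = x - (f x / f e) • e := by
      funext j
      simp [s, eval_linPoly]
      ring
    rw [map_zero, aeval_def, eval_eval₂, algebraMap_eq, hx,
      RingHom.ext (fun c => eval_C c) (g := RingHom.id K) (f := (eval x).comp C)]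
    refine h _ ?_
    have : f e ≠ 0 := hi
    simp [this]
  have hmod : Ideal.Quotient.mk (Ideal.span {linPoly f}) (aeval s P)
      = Ideal.Quotient.mk (Ideal.span {linPoly f}) P := by
    have hf0 : Ideal.Quotient.mk (Ideal.span {linPoly f}) (linPoly f) = 0 :=
      Ideal.Quotient.eq_zero_iff_mem.2 (Ideal.mem_span_singleton_self _)
    refine RingHom.congr_fun (f := (Ideal.Quotient.mk _).comp (aeval s).toRingHom)
      (MvPolynomial.ringHom_ext (fun c => ?_) fun j => ?_) P
    · simp [algebraMap_eq]
    · simp [s, hf0]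
  rw [hs, map_zero, eq_comm, Ideal.Quotient.eq_zero_iff_mem] at hmod
  exact Ideal.mem_span_singleton.1 hmod

end Perp

namespace Cyc

/-- The element `1 + 2ζ + 2ζ⁴` of `ℤ[ζ]`, a square root of `5`. -/
def sqrtFive : Cyc := ⟨-1, 0, -2, -2⟩

lemma sqrtFive_sq : sqrtFive ^ 2 = 5 := by
  decide +kernel

/-- The linear form that, on the plane orthogonal to `normal 15`, determines the coordinates along
the axes together with the first axis. -/
def pencilAxis : Fin 3 → Cyc := sqrtFive • axis 1 - axis 0

lemma axis_sub_pencil (j : Fin 5) :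
    sqrtFive • axis j.succ - axis 0 - zeta ^ (j : ℕ) • pencilAxis
      = (sqrtFive • axis j.succ - axis 0 - zeta ^ (j : ℕ) • pencilAxis) 0 • normal 15 := by
  revert j; decide +kernel

lemma coaxis_zero_dotProduct_normal : coaxis 0 ⬝ᵥ normal 15 = 0 := by
  decide +kernel

lemma coaxis_succ_dotProduct_normal (j : Fin 5) :
    coaxis j.succ ⬝ᵥ normal 15 = coaxis 1 ⬝ᵥ normal 15 * zeta ^ (j : ℕ) := by
  revert j; decide +kernel

lemma normal_zero_vecMul_gen : normal 0 ᵥ* gen 1 = -normal 0 := by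
  decide +kernel

variable {ζ : ℂ} (hζ : IsPrimitiveRoot ζ 5)

/-- The complex vector with coordinates in `ℤ[ζ]`. -/
noncomputable def vec {n : ℕ} (v : Fin n → Cyc) : Fin n → ℂ := fun i => toComplex hζ (v i)

/-- The complex matrix of a generator of the reflection group. -/
noncomputable def genMatrix (k : Fin 3) : Matrix (Fin 3) (Fin 3) ℂ := (gen k).map (toComplex hζ)

lemma vec_dotProduct (v w : Fin 3 → Cyc) : vec hζ v ⬝ᵥ vec hζ w = toComplex hζ (v ⬝ᵥ w) :=
  (RingHom.map_dotProduct _ _ _).symm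

lemma vec_cross (v w : Fin 3 → Cyc) : vec hζ v ⨯₃ vec hζ w = vec hζ (v ⨯₃ w) := by
  ext i
  fin_cases i <;> simp [vec, cross_apply]

lemma vec_vecMul (v : Fin 3 → Cyc) (k : Fin 3) :
    vec hζ v ᵥ* genMatrix hζ k = vec hζ (v ᵥ* gen k) :=
  funext fun i => (RingHom.map_vecMul (toComplex hζ) (gen k) v i).symm

lemma genMatrix_mulVec (v : Fin 3 → Cyc) (k : Fin 3) :
    genMatrix hζ k *ᵥ vec hζ v = vec hζ (gen k *ᵥ v) :=
  funext fun i => (RingHom.map_mulVec (toComplex hζ) (gen k) v i).symm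

lemma vec_smul (c : Cyc) (v : Fin 3 → Cyc) : vec hζ (c • v) = toComplex hζ c • vec hζ v := by
  ext i
  simp [vec]

lemma vec_sub (v w : Fin 3 → Cyc) : vec hζ (v - w) = vec hζ v - vec hζ w := by
  ext i
  simp [vec]

lemma vec_neg (v : Fin 3 → Cyc) : vec hζ (-v) = -vec hζ v := by
  ext i
  simp [vec]

lemma vec_eq_zero {v : Fin 3 → Cyc} : vec hζ v = 0 ↔ v = 0 := by
  refine ⟨fun h => funext fun i => toComplex_injective hζ ?_, fun h => ?_⟩
  · simpa [vec] using congrFun h i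
  · ext i
    simp [vec, h]

lemma genMatrix_mul_self (k : Fin 3) : genMatrix hζ k * genMatrix hζ k = 1 := by
  rw [genMatrix, ← Matrix.map_mul, gen_mul_self, Matrix.map_one _ (map_zero _) (map_one _)]

/-- The coordinates of a point along the axes. -/
noncomputable def coord (x : Fin 3 → ℂ) : Fin 6 → ℂ := fun i => vec hζ (axis i) ⬝ᵥ x

/-- The pairings of a linear form against the axes. -/
noncomputable def polar (w : Fin 3 → ℂ) : Fin 6 → ℂ := fun i => vec hζ (coaxis i) ⬝ᵥ w

/-- The plane orthogonal to `w` is preserved by the invariant derivations. -/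
def Tangent (w : Fin 3 → ℂ) : Prop :=
  ∀ x, w ⬝ᵥ x = 0 →
    psi₁₁ (polar hζ w) (coord hζ x) = 0 ∧ psi₁₅ (polar hζ w) (coord hζ x) = 0

lemma coord_genMatrix (k : Fin 3) (x : Fin 3 → ℂ) :
    coord hζ (genMatrix hζ k *ᵥ x)
      = fun j => toComplex hζ (axisSign k j) * coord hζ x (axisPerm k j) := by
  ext j
  rw [coord, dotProduct_mulVec, vec_vecMul, axis_vecMul_gen, vec_smul, smul_dotProduct,
    smul_eq_mul, coord]

lemma polar_genMatrix (k : Fin 3) (w : Fin 3 → ℂ) :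
    polar hζ w
      = fun j => toComplex hζ (axisSign k j) * polar hζ (w ᵥ* genMatrix hζ k) (axisPerm k j) := by
  ext j
  rw [polar, polar, dotProduct_comm _ (w ᵥ* _), ← dotProduct_mulVec, genMatrix_mulVec,
    ← smul_eq_mul, ← dotProduct_smul, ← vec_smul, gen_mulVec_coaxis, dotProduct_comm]

lemma psi₁₁_genMatrix (k : Fin 3) (w x : Fin 3 → ℂ) :
    psi₁₁ (polar hζ w) (coord hζ (genMatrix hζ k *ᵥ x))
      = psi₁₁ (polar hζ (w ᵥ* genMatrix hζ k)) (coord hζ x) := by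
  rw [coord_genMatrix, polar_genMatrix hζ k w]
  exact psi₁₁_signed_comp (axisPerm_involutive k).bijective
    (fun i => by rw [← map_pow, axisSign_sq, map_one]) _ _

lemma psi₁₅_genMatrix (k : Fin 3) (w x : Fin 3 → ℂ) :
    psi₁₅ (polar hζ w) (coord hζ (genMatrix hζ k *ᵥ x))
      = psi₁₅ (polar hζ (w ᵥ* genMatrix hζ k)) (coord hζ x) := by
  rw [coord_genMatrix, polar_genMatrix hζ k w]
  exact psi₁₅_signed_comp (axisPerm_involutive k).bijective
    (fun i => by rw [← map_pow, axisSign_sq, map_one]) _ _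

lemma Tangent.vecMul {w : Fin 3 → ℂ} (h : Tangent hζ w) (k : Fin 3) :
    Tangent hζ (w ᵥ* genMatrix hζ k) := fun x hx => by
  rw [← dotProduct_mulVec] at hx
  rw [← psi₁₁_genMatrix, ← psi₁₅_genMatrix]
  exact h _ hx

lemma tangent_normal_zero : Tangent hζ (vec hζ (normal 0)) := fun x hx => by
  have hx0 : x 0 = 0 := by
    simpa [vec, normal, dotProduct, Fin.sum_univ_three] using hx
  have hfix : genMatrix hζ 1 *ᵥ x = x := by
    ext i
    fin_cases i <;>
      simp [genMatrix, gen, Matrix.mulVec, dotProduct, Fin.sum_univ_three, hx0]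
  have hneg : polar hζ (vec hζ (normal 0) ᵥ* genMatrix hζ 1)
      = fun i => -polar hζ (vec hζ (normal 0)) i := by
    rw [vec_vecMul, normal_zero_vecMul_gen, vec_neg]
    ext i
    simp [polar]
  have h₁₁ := psi₁₁_genMatrix hζ 1 (vec hζ (normal 0)) x
  have h₁₅ := psi₁₅_genMatrix hζ 1 (vec hζ (normal 0)) x
  rw [hfix, hneg, psi₁₁_neg] at h₁₁
  rw [hfix, hneg, psi₁₅_neg] at h₁₅
  exact ⟨self_eq_neg.1 h₁₁, self_eq_neg.1 h₁₅⟩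

lemma tangent_normal_isotropic : Tangent hζ (vec hζ (normal 15)) := fun x hx => by
  set s := toComplex hζ sqrtFive
  have hs : s ^ 2 = 5 := by rw [← map_pow, sqrtFive_sq, map_ofNat]
  have hs0 : s ≠ 0 := by
    rintro h
    norm_num [h] at hs
  have hpolar : polar hζ (vec hζ (normal 15)) = Fin.cons 0 fun j : Fin 5 =>
      toComplex hζ (coaxis 1 ⬝ᵥ normal 15) * ζ ^ (j : ℕ) := by
    refine funext (Fin.cases ?_ fun j => ?_)
    · rw [polar, vec_dotProduct, coaxis_zero_dotProduct_normal, map_zero, Fin.cons_zero]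
    · rw [polar, vec_dotProduct, coaxis_succ_dotProduct_normal, map_mul, map_pow, toComplex_zeta,
        Fin.cons_succ]
  have hcoord : (fun i => s * coord hζ x i) = Fin.cons (s * coord hζ x 0) fun j : Fin 5 =>
      coord hζ x 0 + ζ ^ (j : ℕ) * (vec hζ pencilAxis ⬝ᵥ x) := by
    refine funext (Fin.cases ?_ fun j => ?_)
    · rw [Fin.cons_zero]
    · have h := congrArg (fun v => vec hζ v ⬝ᵥ x) (axis_sub_pencil j)
      simp only [vec_sub, vec_smul, sub_dotProduct, smul_dotProduct, hx, map_pow,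
        toComplex_zeta, smul_eq_mul] at h
      rw [Fin.cons_succ]
      simp only [coord]
      linear_combination h
  constructor
  · have h := psi₁₁_mul s (polar hζ (vec hζ (normal 15))) (coord hζ x)
    rw [hcoord, hpolar, psi₁₁_isotropic (sum_pow_eq_zero hζ) hs] at h
    rw [hpolar]
    exact (mul_eq_zero.1 h.symm).resolve_left (pow_ne_zero _ hs0)
  · have h := psi₁₅_mul s (polar hζ (vec hζ (normal 15))) (coord hζ x)
    rw [hcoord, hpolar, psi₁₅_isotropic (sum_pow_eq_zero hζ) hs] at h
    rw [hpolar]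
    exact (mul_eq_zero.1 h.symm).resolve_left (pow_ne_zero _ hs0)

/-- A property of complex vectors holding for `normal 0` and `normal 15` and stable under the
generators holds for all normal vectors. -/
lemma normal_induction {p : (Fin 3 → ℂ) → Prop} (h₀ : p (vec hζ (normal 0)))
    (h₁₅ : p (vec hζ (normal 15))) (h : ∀ w k, p w → p (w ᵥ* genMatrix hζ k)) (i : Fin 27) :
    p (vec hζ (normal i)) := by
  induction i using WellFoundedLT.induction with
  | ind i ih =>
    by_cases hi₀ : i = 0
    · exact hi₀ ▸ h₀
    by_cases hi₁₅ : i = 15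
    · exact hi₁₅ ▸ h₁₅
    obtain ⟨j, hj, k, hk⟩ := exists_normal_eq_vecMul i hi₀ hi₁₅
    rw [hk, ← vec_vecMul]
    exact h _ k (ih j hj)

lemma tangent_normal (i : Fin 27) : Tangent hζ (vec hζ (normal i)) :=
  normal_induction hζ (tangent_normal_zero hζ) (tangent_normal_isotropic hζ)
    (fun _ k hw => hw.vecMul hζ k) i

end Cyc

section Homogeneous

variable {K : Type*} [Field K] {n m : ℕ}

lemma isHomogeneous_powSum {a : Fin m → MvPolynomial (Fin n) K} {d : ℕ}
    (ha : ∀ i, (a i).IsHomogeneous d) (k : ℕ) : (powSum a k).IsHomogeneous (d * k) :=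
  IsHomogeneous.sum _ _ _ fun i _ => (ha i).pow k

lemma isHomogeneous_wPowSum {a : Fin m → MvPolynomial (Fin n) K} {d : ℕ}
    (ha : ∀ i, (a i).IsHomogeneous d) (b : Fin m → K) (k : ℕ) :
    (wPowSum (fun i => C (b i)) a k).IsHomogeneous (d * k) :=
  IsHomogeneous.sum _ _ _ fun i _ => ((ha i).pow k).C_mul _

lemma isHomogeneous_psi₁₁ {a : Fin 6 → MvPolynomial (Fin n) K}
    (ha : ∀ i, (a i).IsHomogeneous 1) (b : Fin 6 → K) :
    (psi₁₁ (fun i => C (b i)) a).IsHomogeneous 11 := by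
  have hp := isHomogeneous_powSum ha
  have hw := isHomogeneous_wPowSum ha b
  simp only [psi₁₁, ← map_ofNat (C : K →+* MvPolynomial (Fin n) K)]
  exact (((hp 2).C_mul _).mul (hw 9)).sub
    ((((hp 6).C_mul _).add (((hp 2).pow 3).C_mul _)).mul (hw 5))

lemma isHomogeneous_psi₁₅ {a : Fin 6 → MvPolynomial (Fin n) K}
    (ha : ∀ i, (a i).IsHomogeneous 1) (b : Fin 6 → K) :
    (psi₁₅ (fun i => C (b i)) a).IsHomogeneous 15 := by
  have hp := isHomogeneous_powSum ha
  have hw := isHomogeneous_wPowSum ha b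
  simp only [psi₁₅, ← map_ofNat (C : K →+* MvPolynomial (Fin n) K)]
  exact ((((hp 10).C_mul _).add (((hp 2).pow 5).C_mul _)).mul (hw 5)).sub
    ((((hp 6).C_mul _).add (((hp 2).pow 3).C_mul _)).mul (hw 9))

end Homogeneous

namespace Cyc

variable {ζ : ℂ} (hζ : IsPrimitiveRoot ζ 5)

/-- The invariant derivation of degree 11. -/
noncomputable def der₁₁ : Derivation ℂ (MvPolynomial (Fin 3) ℂ) (MvPolynomial (Fin 3) ℂ) :=
  mkDerivation ℂ fun j =>
    psi₁₁ (fun i => C (vec hζ (coaxis i) j)) (fun i => linPoly (lf (vec hζ (axis i))))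

/-- The invariant derivation of degree 15. -/
noncomputable def der₁₅ : Derivation ℂ (MvPolynomial (Fin 3) ℂ) (MvPolynomial (Fin 3) ℂ) :=
  mkDerivation ℂ fun j =>
    psi₁₅ (fun i => C (vec hζ (coaxis i) j)) (fun i => linPoly (lf (vec hζ (axis i))))

lemma isHomogeneous_der₁₁ (j : Fin 3) : (der₁₁ hζ (X j)).IsHomogeneous 11 := by
  rw [der₁₁, mkDerivation_X]
  exact isHomogeneous_psi₁₁ (fun _ => isHomogeneous_linPoly _) _

lemma isHomogeneous_der₁₅ (j : Fin 3) : (der₁₅ hζ (X j)).IsHomogeneous 15 := by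
  rw [der₁₅, mkDerivation_X]
  exact isHomogeneous_psi₁₅ (fun _ => isHomogeneous_linPoly _) _

lemma eval_der₁₁_X (x : Fin 3 → ℂ) (j : Fin 3) :
    eval x (der₁₁ hζ (X j)) = psi₁₁ (fun i => vec hζ (coaxis i) j) (coord hζ x) := by
  rw [der₁₁, mkDerivation_X, map_psi₁₁]
  simp only [eval_C, eval_linPoly, lf_apply]
  rfl

lemma eval_der₁₅_X (x : Fin 3 → ℂ) (j : Fin 3) :
    eval x (der₁₅ hζ (X j)) = psi₁₅ (fun i => vec hζ (coaxis i) j) (coord hζ x) := by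
  rw [der₁₅, mkDerivation_X, map_psi₁₅]
  simp only [eval_C, eval_linPoly, lf_apply]
  rfl

lemma eval_der₁₁_linPoly (x w : Fin 3 → ℂ) :
    eval x (der₁₁ hζ (linPoly (lf w))) = psi₁₁ (polar hζ w) (coord hζ x) := by
  simp only [derivation_linPoly, map_sum, map_mul, eval_C, eval_der₁₁_X, lf_single, sum_mul_psi₁₁]
  congr 1
  ext i
  rw [polar, dotProduct_comm, dotProduct]

lemma eval_der₁₅_linPoly (x w : Fin 3 → ℂ) :
    eval x (der₁₅ hζ (linPoly (lf w))) = psi₁₅ (polar hζ w) (coord hζ x) := by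
  simp only [derivation_linPoly, map_sum, map_mul, eval_C, eval_der₁₅_X, lf_single, sum_mul_psi₁₅]
  congr 1
  ext i
  rw [polar, dotProduct_comm, dotProduct]

lemma eval_der₁₁_vec (x : Fin 3 → Cyc) (j : Fin 3) :
    eval (vec hζ x) (der₁₁ hζ (X j)) = vec hζ (field₁₁ x) j := by
  rw [eval_der₁₁_X, vec, field₁₁, map_psi₁₁]
  simp only [← vec_dotProduct]
  rfl

lemma eval_der₁₅_vec (x : Fin 3 → Cyc) (j : Fin 3) :
    eval (vec hζ x) (der₁₅ hζ (X j)) = vec hζ (field₁₅ x) j := by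
  rw [eval_der₁₅_X, vec, field₁₅, map_psi₁₅]
  simp only [← vec_dotProduct]
  rfl

lemma normal_ne_zero (i : Fin 27) : normal i ≠ 0 := fun h => by
  obtain ⟨j, hj⟩ := exists_ne i
  exact normal_cross_ne_zero j i hj (by rw [h, map_zero])

lemma vec_normal_ne_zero (i : Fin 27) : vec hζ (normal i) ≠ 0 :=
  (vec_eq_zero hζ).not.2 (normal_ne_zero i)

lemma perp_normal_injective : Function.Injective fun i => perp (vec hζ (normal i)) := by
  intro i j h
  by_contra hij
  refine normal_cross_ne_zero i j hij ((vec_eq_zero hζ).1 ?_)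
  rw [← vec_cross]
  exact (perp_eq_iff (vec_normal_ne_zero hζ i) (vec_normal_ne_zero hζ j)).1 h

lemma eval_coeffVec_eulerDer (x : Fin 3 → ℂ) (i : Fin 3) :
    eval x (coeffVec (eulerDer ℂ 3) i) = x i := by
  rw [coeffVec, eulerDer_X, eval_X]

lemma map_cross {R S : Type*} [CommRing R] [CommRing S] (f : R →+* S) (u v : Fin 3 → R) :
    (fun i => f ((u ⨯₃ v) i)) = (fun i => f (u i)) ⨯₃ fun i => f (v i) := by
  ext i
  fin_cases i <;> simp [cross_apply]

lemma eval_cross_eulerDer_der₁₁ (x : Fin 3 → Cyc) :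
    (fun i => eval (vec hζ x) ((coeffVec (eulerDer ℂ 3) ⨯₃ coeffVec (der₁₁ hζ)) i))
      = vec hζ (x ⨯₃ field₁₁ x) := by
  have h₁ : (fun i => eval (vec hζ x) (coeffVec (eulerDer ℂ 3) i)) = vec hζ x := by
    ext i
    rw [eval_coeffVec_eulerDer]
  have h₂ : (fun i => eval (vec hζ x) (coeffVec (der₁₁ hζ) i)) = vec hζ (field₁₁ x) := by
    ext i
    rw [coeffVec, eval_der₁₁_vec]
  rw [map_cross, ← vec_cross, h₁, h₂]

section Arrangement

variable {hζ} {A : Arrangement ℂ 3} {Q : MvPolynomial (Fin 3) ℂ}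
  (hA : A.hyperplanes = Finset.univ.image fun i => perp (vec hζ (normal i)))
include hA

lemma card_hyperplanes : A.hyperplanes.card = 27 := by
  rw [hA, Finset.card_image_of_injective _ (perp_normal_injective hζ), Finset.card_univ,
    Fintype.card_fin]

lemma mem_derModule_of_tangent (hQ : IsDefiningPoly A Q)
    {θ : Derivation ℂ (MvPolynomial (Fin 3) ℂ) (MvPolynomial (Fin 3) ℂ)}
    (h : ∀ i x, vec hζ (normal i) ⬝ᵥ x = 0 → eval x (θ (linPoly (lf (vec hζ (normal i))))) = 0) :
    θ ∈ DerModule Q := by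
  refine (mem_derModule_iff hQ).2 fun f hf hfA => ?_
  rw [hA, Finset.mem_image] at hfA
  obtain ⟨i, -, hi⟩ := hfA
  have hn := lf_ne_zero (vec_normal_ne_zero hζ i)
  rw [← linPoly_dvd_derivation_iff hn hf hi]
  exact linPoly_dvd_of_eval_eq_zero hn fun x hx => h i x (by rwa [lf_apply] at hx)

lemma der₁₁_mem (hQ : IsDefiningPoly A Q) : der₁₁ hζ ∈ DerModule Q :=
  mem_derModule_of_tangent hA hQ fun i x hx => by
    rw [eval_der₁₁_linPoly]
    exact (tangent_normal hζ i x hx).1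

lemma der₁₅_mem (hQ : IsDefiningPoly A Q) : der₁₅ hζ ∈ DerModule Q :=
  mem_derModule_of_tangent hA hQ fun i x hx => by
    rw [eval_der₁₅_linPoly]
    exact (tangent_normal hζ i x hx).2

lemma exists_det_eq (hQ : IsDefiningPoly A Q) :
    ∃ c : ℂ, c ≠ 0 ∧ (coeffMatrix ![eulerDer ℂ 3, der₁₁ hζ, der₁₅ hζ]).det = C c * Q := by
  have hmem : ∀ i, (![eulerDer ℂ 3, der₁₁ hζ, der₁₅ hζ] : Fin 3 → _) i ∈ DerModule Q := by
    intro i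
    fin_cases i
    exacts [eulerDer_mem hQ, der₁₁_mem hA hQ, der₁₅_mem hA hQ]
  have hhom : (coeffMatrix ![eulerDer ℂ 3, der₁₁ hζ, der₁₅ hζ]).det.IsHomogeneous 27 := by
    refine isHomogeneous_det (d := ![1, 11, 15]) fun i j => ?_
    fin_cases i
    exacts [isHomogeneous_eulerDer j, isHomogeneous_der₁₁ hζ j, isHomogeneous_der₁₅ hζ j]
  have hne : (coeffMatrix ![eulerDer ℂ 3, der₁₁ hζ, der₁₅ hζ]).det ≠ 0 := by
    intro h
    rw [det_coeffMatrix_three] at h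
    have h' := congrArg (eval (vec hζ ![1, 2, 5])) h
    rw [dotProduct, map_sum, map_zero] at h'
    simp only [map_mul] at h'
    have h₁ := congrFun (eval_cross_eulerDer_der₁₁ hζ ![1, 2, 5])
    have h₂ := eval_der₁₅_vec hζ ![1, 2, 5]
    simp only [h₁, coeffVec, h₂] at h'
    refine det_fields_ne_zero (toComplex_injective hζ ?_)
    rw [← vec_dotProduct, map_zero]
    exact h'
  obtain ⟨P, hP⟩ := definingPoly_dvd_det hQ hmem
  have hQ0 := definingPoly_ne_zero hQ
  have hP0 : P ≠ 0 := by
    rintro rfl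
    exact hne (by rw [hP, mul_zero])
  have hdeg := totalDegree_mul_of_isDomain hQ0 hP0
  have hQhom := isHomogeneous_definingPoly hQ
  rw [card_hyperplanes hA] at hQhom
  rw [← hP, hhom.totalDegree hne, hQhom.totalDegree hQ0] at hdeg
  have hPC := totalDegree_eq_zero_iff_eq_C.1 (show P.totalDegree = 0 by omega)
  refine ⟨P.coeff 0, fun h => hP0 (by rw [hPC, h, C_0]), ?_⟩
  rw [hP, ← hPC, mul_comm]

lemma hasExponents : HasExponents A {1, 11, 15} := by
  obtain ⟨Q, hQ⟩ := exists_isDefiningPoly A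
  obtain ⟨c, hc, hdet⟩ := exists_det_eq hA hQ
  have hmem : ∀ i, (![eulerDer ℂ 3, der₁₁ hζ, der₁₅ hζ] : Fin 3 → _) i ∈ DerModule Q := by
    intro i
    fin_cases i
    exacts [eulerDer_mem hQ, der₁₁_mem hA hQ, der₁₅_mem hA hQ]
  obtain ⟨b, hb⟩ := exists_basis_of_det_eq hQ hmem hc hdet
  refine ⟨Q, hQ, [1, 11, 15], b, rfl, fun i => ⟨?_, ?_⟩⟩
  · exact fun h => b.ne_zero i (Subtype.ext h)
  · rw [hb]
    fin_cases i
    exacts [isHomogeneous_eulerDer, isHomogeneous_der₁₁ hζ, isHomogeneous_der₁₅ hζ]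

lemma exists_not_dvd_cross (g : (Fin 3 → ℂ) →ₗ[ℂ] ℂ) (hg : LinearMap.ker g ∈ A.hyperplanes) :
    ∃ i, ¬ linPoly g ∣ (coeffVec (eulerDer ℂ 3) ⨯₃ coeffVec (der₁₁ hζ)) i := by
  by_contra! h
  rw [hA, Finset.mem_image] at hg
  obtain ⟨i, -, hi⟩ := hg
  have hx : g (vec hζ (normal i ⨯₃ ![1, 2, 5])) = 0 := by
    rw [← LinearMap.mem_ker, ← hi, mem_perp, vec_dotProduct, dot_self_cross, map_zero]
  refine cross_field_ne_zero i ((vec_eq_zero hζ).1 ?_)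
  rw [← eval_cross_eulerDer_der₁₁]
  ext j
  obtain ⟨P, hP⟩ := h j
  rw [hP, map_mul, eval_linPoly, hx, zero_mul, Pi.zero_apply]

lemma card_restriction_le {H : Submodule ℂ (Fin 3 → ℂ)} (hH : H ∈ A.hyperplanes)
    {B : Arrangement ℂ 2} (hB : IsRestriction A H B) : B.hyperplanes.card ≤ 11 := by
  obtain ⟨e, he⟩ := hB
  rw [hA, Finset.mem_image] at hH
  obtain ⟨i, -, rfl⟩ := hH
  have hsub : B.hyperplanes ⊆ ((flats.filter (i ∈ ·)).toFinset).image fun L =>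
      Submodule.map (e : perp (vec hζ (normal i)) →ₗ[ℂ] (Fin 2 → ℂ))
        ((Submodule.span ℂ {vec hζ (flatPoint L)}).comap (perp (vec hζ (normal i))).subtype) := by
    rw [he, hA]
    intro Y hY
    obtain ⟨H', hH', rfl⟩ := Finset.mem_image.1 hY
    obtain ⟨hne, hH'⟩ := Finset.mem_erase.1 hH'
    obtain ⟨j, -, rfl⟩ := Finset.mem_image.1 hH'
    have hij : i ≠ j := by
      rintro rfl
      exact hne rfl
    obtain ⟨L, hL, hiL, hjL⟩ := exists_mem_flats i j hij
    refine Finset.mem_image.2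
      ⟨L, List.mem_toFinset.2 (List.mem_filter.2 ⟨hL, by simpa using hiL⟩), ?_⟩
    have hdot : ∀ k ∈ L, vec hζ (normal k) ⬝ᵥ vec hζ (flatPoint L) = 0 := fun k hk => by
      rw [vec_dotProduct, normal_dotProduct_flatPoint L hL k hk, map_zero]
    rw [← perp_inf_perp (v := vec hζ (normal i)) (w := vec hζ (normal j)) ?_
      ((vec_eq_zero hζ).not.2 (flatPoint_ne_zero L hL)) (hdot i hiL) (hdot j hjL),
      Submodule.comap_inf, Submodule.comap_subtype_self, top_inf_eq]
    rw [vec_cross]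
    exact (vec_eq_zero hζ).not.2 (normal_cross_ne_zero i j hij)
  exact (Finset.card_le_card hsub).trans (Finset.card_image_le.trans
    ((List.toFinset_card_le _).trans (length_filter_flats_le i)))

lemma not_inductivelyFree : ¬ InductivelyFree ℂ A := by
  obtain ⟨Q, hQ⟩ := exists_isDefiningPoly A
  obtain ⟨c, hc, hdet⟩ := exists_det_eq hA hQ
  exact not_inductivelyFree_of_restriction_card_le hQ (der₁₁_mem hA hQ) (isHomogeneous_der₁₁ hζ)
    (by rw [card_hyperplanes hA]; norm_num) hc hdet (fun g _ hg => exists_not_dvd_cross hA g hg)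
    fun H hH B hB => card_restriction_le hA hH hB

end Arrangement

end Cyc

namespace Cyc

variable {ζ : ℂ} (hζ : IsPrimitiveRoot ζ 5)

/-- The nonzero multiples of the normal vectors. -/
def IsMultiple (v : Fin 3 → ℂ) : Prop := ∃ i, ∃ c : ℂ, c ≠ 0 ∧ v = c • vec hζ (normal i)

lemma isMultiple_normal (i : Fin 27) : IsMultiple hζ (vec hζ (normal i)) :=
  ⟨i, 1, one_ne_zero, (one_smul _ _).symm⟩

lemma IsMultiple.vecMul {v : Fin 3 → ℂ} (h : IsMultiple hζ v) (k : Fin 3) :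
    IsMultiple hζ (v ᵥ* genMatrix hζ k) := by
  obtain ⟨i, c, hc, rfl⟩ := h
  obtain ⟨j, hj⟩ := exists_normal_cross_vecMul i k
  have hne : vec hζ (normal i ᵥ* gen k) ≠ 0 := fun h => by
    refine vec_normal_ne_zero hζ i ?_
    have := congrArg (· ᵥ* genMatrix hζ k) h
    simpa [← vec_vecMul, Matrix.vecMul_vecMul, genMatrix_mul_self] using this
  obtain ⟨d, hd⟩ := exists_smul_of_cross_eq_zero (vec_normal_ne_zero hζ j)
    (w := vec hζ (normal i ᵥ* gen k)) (by
      rw [← cross_anticomm, vec_cross, hj, (vec_eq_zero hζ).2 rfl, neg_zero])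
  refine ⟨j, c * d, mul_ne_zero hc fun h => hne (by rw [← hd, h, zero_smul]), ?_⟩
  rw [Matrix.smul_vecMul, vec_vecMul, ← hd, smul_smul]

lemma isMultiple_of_mem_closure {S : Set (GL (Fin 3) ℂ)}
    (hS : ∀ g ∈ S, ∃ k, (g : Matrix (Fin 3) (Fin 3) ℂ) = genMatrix hζ k)
    {g : GL (Fin 3) ℂ} (hg : g ∈ Subgroup.closure S) :
    ∀ v, IsMultiple hζ v → IsMultiple hζ (v ᵥ* (g : Matrix (Fin 3) (Fin 3) ℂ)) := by
  induction hg using Subgroup.closure_induction'' with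
  | mem x hx =>
    obtain ⟨k, hk⟩ := hS x hx
    exact fun v hv => hk ▸ hv.vecMul hζ k
  | inv_mem x hx =>
    obtain ⟨k, hk⟩ := hS x hx
    have hinv : x⁻¹ = x := inv_eq_of_mul_eq_one_left
      (Units.ext (by rw [Units.val_mul, hk, genMatrix_mul_self, Units.val_one]))
    exact fun v hv => by rw [hinv, hk]; exact hv.vecMul hζ k
  | one => simp
  | mul x y _ _ hx hy =>
    intro v hv
    rw [Units.val_mul, ← Matrix.vecMul_vecMul]
    exact hy _ (hx _ hv)

lemma vec_normal_simple : vec hζ (normal 0) = Pi.single 0 1 ∧ vec hζ (normal 8) = Pi.single 1 1 ∧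
    vec hζ (normal 14) = Pi.single 2 1 := by
  refine ⟨?_, ?_, ?_⟩ <;> ext i <;> fin_cases i <;> simp [vec, normal]

lemma toComplex_omega : toComplex hζ omega = -ζ ^ 2 - ζ ^ 3 := by
  simp [toComplex_apply, omega, sub_eq_add_neg]

lemma toComplex_neg_zeta_sq : toComplex hζ ⟨0, 0, -1, 0⟩ = -ζ ^ 2 := by
  simp [toComplex_apply]

lemma vec_normal_isotropic : vec hζ (normal 15) = ![1, -ζ ^ 2, 0] := by
  ext i
  fin_cases i <;> simp [vec, normal, toComplex_neg_zeta_sq]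

/-- The orbit of the simple roots and the isotropic vector under the reflection group. -/
lemma image_perp_orbit {S : Set (GL (Fin 3) ℂ)}
    (hS : ∀ g ∈ S, ∃ k, (g : Matrix (Fin 3) (Fin 3) ℂ) = genMatrix hζ k)
    (hS' : ∀ k, ∃ g ∈ S, (g : Matrix (Fin 3) (Fin 3) ℂ) = genMatrix hζ k) :
    perp '' ({w | ∃ g ∈ Subgroup.closure S, ∃ i : Fin 3,
          w = Matrix.vecMul (Pi.single i 1) (g : Matrix (Fin 3) (Fin 3) ℂ)} ∪
        {w | ∃ g ∈ Subgroup.closure S,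
          w = Matrix.vecMul ![1, -ζ^2, 0] (g : Matrix (Fin 3) (Fin 3) ℂ)})
      = Set.range fun i => perp (vec hζ (normal i)) := by
  obtain ⟨h₀, h₁, h₂⟩ := vec_normal_simple hζ
  apply Set.Subset.antisymm
  · rintro _ ⟨w, hw, rfl⟩
    have hm : IsMultiple hζ w := by
      rcases hw with ⟨g, hg, i, rfl⟩ | ⟨g, hg, rfl⟩
      · refine isMultiple_of_mem_closure hζ hS hg _ ?_
        fin_cases i
        exacts [h₀ ▸ isMultiple_normal hζ 0, h₁ ▸ isMultiple_normal hζ 8,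
          h₂ ▸ isMultiple_normal hζ 14]
      · exact isMultiple_of_mem_closure hζ hS hg _
          (vec_normal_isotropic hζ ▸ isMultiple_normal hζ 15)
    obtain ⟨i, c, hc, rfl⟩ := hm
    exact ⟨i, (perp_smul hc _).symm⟩
  · rintro _ ⟨i, rfl⟩
    refine Set.mem_image_of_mem _ (normal_induction hζ ?_ ?_ ?_ i)
    · exact Or.inl ⟨1, one_mem _, 0, by simp [h₀]⟩
    · exact Or.inr ⟨1, one_mem _, by simp [vec_normal_isotropic]⟩
    · intro w k hw
      obtain ⟨g', hg', hk⟩ := hS' k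
      have hmem := Subgroup.subset_closure hg'
      rw [← hk]
      rcases hw with ⟨g, hg, i, rfl⟩ | ⟨g, hg, rfl⟩
      · exact Or.inl ⟨g * g', mul_mem hg hmem, i, by rw [Units.val_mul, Matrix.vecMul_vecMul]⟩
      · exact Or.inr ⟨g * g', mul_mem hg hmem, by rw [Units.val_mul, Matrix.vecMul_vecMul]⟩

end Cyc

end Arrgt


open Arrgt in
/-- The 27-hyperplane arrangement `𝓐` is free with exponents `{{1, 11, 15}}` but
not inductively free. -/
theorem H3A_free_not_inductivelyFree
    (ζ : ℂ) (hζ : IsPrimitiveRoot ζ 5)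
    (g1 g2 g3 : GL (Fin 3) ℂ)
    (hg1 : (g1 : Matrix (Fin 3) (Fin 3) ℂ) = !![1, 0, 0; 0, 1, 1; 0, 0, -1])
    (hg2 : (g2 : Matrix (Fin 3) (Fin 3) ℂ) = !![-1, 0, 0; -ζ^2 - ζ^3, 1, 0; 0, 0, 1])
    (hg3 : (g3 : Matrix (Fin 3) (Fin 3) ℂ) = !![1, -ζ^2 - ζ^3, 0; 0, -1, 0; 0, 1, 1])
    (W : Subgroup (GL (Fin 3) ℂ)) (hW : W = Subgroup.closure {g1, g2, g3})
    (R : Set (Fin 3 → ℂ))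
    (hR : R = {w | ∃ g ∈ W, ∃ i : Fin 3,
          w = Matrix.vecMul (Pi.single i 1) (g : Matrix (Fin 3) (Fin 3) ℂ)} ∪
        {w | ∃ g ∈ W, w = Matrix.vecMul ![1, -ζ^2, 0] (g : Matrix (Fin 3) (Fin 3) ℂ)})
    (𝓐 : Set (Submodule ℂ (Fin 3 → ℂ))) (h𝓐 : 𝓐 = Arrgt.perp '' R)
    (CA : Arrangement ℂ 3) (hCA : ↑CA.hyperplanes = 𝓐) :
    HasExponents CA ({1, 11, 15} : Multiset ℕ) ∧ ¬ InductivelyFree ℂ CA := by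
  have hG : ∀ k, ((![g1, g2, g3] k : GL (Fin 3) ℂ) : Matrix (Fin 3) (Fin 3) ℂ)
      = Cyc.genMatrix hζ k := by
    intro k
    fin_cases k
    · refine hg1.trans ?_
      ext i j
      fin_cases i <;> fin_cases j <;> simp [Cyc.genMatrix, Cyc.gen]
    · refine hg2.trans ?_
      ext i j
      fin_cases i <;> fin_cases j <;>
        simp [Cyc.genMatrix, Cyc.gen, Cyc.toComplex_omega]
    · refine hg3.trans ?_
      ext i j
      fin_cases i <;> fin_cases j <;>
        simp [Cyc.genMatrix, Cyc.gen, Cyc.toComplex_omega]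
  have hA : CA.hyperplanes
      = Finset.univ.image fun i => perp (Cyc.vec hζ (Cyc.normal i)) := by
    rw [← Finset.coe_inj, hCA, h𝓐, hR, hW, Finset.coe_image, Finset.coe_univ, Set.image_univ]
    refine Cyc.image_perp_orbit hζ ?_ fun k => ⟨_, ?_, hG k⟩
    · rintro g (rfl | rfl | rfl)
      exacts [⟨0, hG 0⟩, ⟨1, hG 1⟩, ⟨2, hG 2⟩]
    · fin_cases k <;> simp
  exact ⟨Cyc.hasExponents hA, Cyc.not_inductivelyFree hA⟩
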